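/- arXiv:1406.1067 — 4 statements merged into one kernel-verified Lean document; each statement's English description precedes it below -/
import Mathlib

section
/- Let q be a power of an odd prime and let L(X) = a_1 X^{q^2} + a_0 X with a_0, a_1 ∈ F_{q^4} and a_1 ≠ 0. Then Tr_{q^4/q}(L(x)/x) ≠ 0 for every nonzero x ∈ F_{q^4} if and only if a_1^{q^2+1} is a nonzero square in F_q (in particular a_1^{q^2+1} ∈ F_q) and Tr_{q^4/q}(a_0) = 0. -/
open Polynomial in
theorem aux_three : ∀ (D s a b : ZMod 3), (∀ t : ZMod 3, t ^ 2 ≠ D) →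
    (∀ t : ZMod 3, ((D * t ^ 2 + s ^ 2 - 4 * a) ^ 2 - D * (2 * s * t - 4 * b) ^ 2) ^ 1 = 1) →
    ¬ (a = 0 ∧ b = 0) → s = 0 ∧ b = 0 := by
  decide

set_option maxRecDepth 100000 in
set_option maxHeartbeats 4000000 in
theorem aux_five : ∀ (D s a b : ZMod 5), (∀ t : ZMod 5, t ^ 2 ≠ D) →
    (∀ t : ZMod 5, ((D * t ^ 2 + s ^ 2 - 4 * a) ^ 2 - D * (2 * s * t - 4 * b) ^ 2) ^ 2 = 1) →
    ¬ (a = 0 ∧ b = 0) → s = 0 ∧ b = 0 := by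
  decide

theorem aux_small {E : Type*} [Field E] (q : ℕ) [Fact q.Prime] [CharP E q] (hq : q = 3 ∨ q = 5)
   (D s a b : E) (hD : D ^ q = D) (hs : s ^ q = s) (ha : a ^ q = a) (hb : b ^ q = b)
   (hD2 : ∀ t : E, t ^ q = t → t ^ 2 ≠ D) (hab : ¬ (a = 0 ∧ b = 0))
   (hg : ∀ t : E, t ^ q = t →
     ((D * t ^ 2 + s ^ 2 - 4 * a) ^ 2 - D * (2 * s * t - 4 * b) ^ 2) ^ ((q - 1) / 2) = 1) :
   s = 0 ∧ b = 0 := by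
  have hinj : Function.Injective (ZMod.castHom (dvd_refl q) E) := (ZMod.castHom (dvd_refl q) E).injective
  have hsurj : ∀ x : E, x ^ q = x → ∃ i : ZMod q, ZMod.castHom (dvd_refl q) E i = x := by
    intro x hx
    have h0 : (q : E) = 0 := CharP.cast_eq_zero E q
    rcases hq with rfl | rfl
    · have h0 : (3 : E) = 0 := by exact_mod_cast h0
      have : x * ((x - 1) * (x - 2)) = 0 := by linear_combination hx + (x - x ^ 2) * h0
      rcases mul_eq_zero.1 this with h | h
      · exact ⟨0, by rw [h, map_zero]⟩
      rcases mul_eq_zero.1 h with h | h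
      · exact ⟨1, by rw [sub_eq_zero.1 h, map_one]⟩
      · exact ⟨2, by rw [sub_eq_zero.1 h, map_ofNat]⟩
    · have h0 : (5 : E) = 0 := by exact_mod_cast h0
      have : x * ((x - 1) * ((x - 2) * ((x - 3) * (x - 4)))) = 0 := by
        linear_combination hx + (5 * x - 10 * x ^ 2 + 7 * x ^ 3 - 2 * x ^ 4) * h0
      rcases mul_eq_zero.1 this with h | h
      · exact ⟨0, by rw [h, map_zero]⟩
      rcases mul_eq_zero.1 h with h | h
      · exact ⟨1, by rw [sub_eq_zero.1 h, map_one]⟩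
      rcases mul_eq_zero.1 h with h | h
      · exact ⟨2, by rw [sub_eq_zero.1 h, map_ofNat]⟩
      rcases mul_eq_zero.1 h with h | h
      · exact ⟨3, by rw [sub_eq_zero.1 h, map_ofNat]⟩
      · exact ⟨4, by rw [sub_eq_zero.1 h, map_ofNat]⟩
  obtain ⟨D, rfl⟩ := hsurj D hD
  obtain ⟨s, rfl⟩ := hsurj s hs
  obtain ⟨a, rfl⟩ := hsurj a ha
  obtain ⟨b, rfl⟩ := hsurj b hb
  have hD2' : ∀ t : ZMod q, t ^ 2 ≠ D := by
    intro t ht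
    refine hD2 (ZMod.castHom (dvd_refl q) E t) ?_ ?_
    · rw [← map_pow, ZMod.pow_card]
    · rw [← map_pow, ht]
  have hg' : ∀ t : ZMod q,
     ((D * t ^ 2 + s ^ 2 - 4 * a) ^ 2 - D * (2 * s * t - 4 * b) ^ 2) ^ ((q - 1) / 2) = 1 := by
    intro t
    apply hinj
    have := hg (ZMod.castHom (dvd_refl q) E t) (by rw [← map_pow, ZMod.pow_card])
    simpa only [map_pow, map_sub, map_mul, map_add, map_ofNat, map_one] using this
  have hab' : ¬ (a = 0 ∧ b = 0) := by
    rintro ⟨rfl, rfl⟩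
    exact hab ⟨map_zero _, map_zero _⟩
  have : s = 0 ∧ b = 0 := by
    clear hD hs ha hb hD2 hab hg hinj hsurj
    rcases hq with rfl | rfl
    · exact aux_three D s a b hD2' hg' hab'
    · exact aux_five D s a b hD2' hg' hab'
  exact ⟨by rw [this.1, map_zero], by rw [this.2, map_zero]⟩

open Polynomial in
theorem aux_dvd {E : Type*} [Field E] [Fintype E] (p k q : ℕ) [hp : Fact p.Prime] [CharP E p] (hk : 0 < k)
   (hqp : q = p ^ k) (hE : Fintype.card E = q ^ 4) (P : E[X]) (hP0 : P ≠ 0)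
   (hP : ∀ t : E, t ^ q = t → P.eval t = 0) : (X ^ q - X : E[X]) ∣ P := by
  have hq1 : 1 < q := hqp ▸ Nat.one_lt_pow hk.ne' hp.out.one_lt
  have hdvd : (X ^ q - X : E[X]) ∣ X ^ Fintype.card E - X := by
    have h1 : (X ^ (q - 1) - 1 : E[X]) ∣ X ^ (q ^ 4 - 1) - 1 := by
      obtain ⟨c, hc⟩ : (q - 1) ∣ q ^ 4 - 1 := by simpa using Nat.sub_dvd_pow_sub_pow q 1 4
      rw [hc, pow_mul]
      simpa using sub_dvd_pow_sub_pow (X ^ (q - 1) : E[X]) 1 c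
    have e1 : (X ^ q - X : E[X]) = X * (X ^ (q - 1) - 1) := by
      rw [mul_sub, ← pow_succ', Nat.sub_add_cancel hq1.le, mul_one]
    have e2 : (X ^ (q ^ 4) - X : E[X]) = X * (X ^ (q ^ 4 - 1) - 1) := by
      rw [mul_sub, ← pow_succ', Nat.sub_add_cancel (Nat.one_le_pow _ _ (by omega)), mul_one]
    rw [hE, e1, e2]
    exact mul_dvd_mul_left _ h1
  have hne : (X ^ Fintype.card E - X : E[X]) ≠ 0 := FiniteField.X_pow_card_sub_X_ne_zero E Fintype.one_lt_card
  have hspl : (X ^ q - X : E[X]).Splits := 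
    Polynomial.Splits.of_dvd (by
      rw [Polynomial.splits_iff_card_roots, FiniteField.roots_X_pow_card_sub_X,
        FiniteField.X_pow_card_sub_X_natDegree_eq E Fintype.one_lt_card]; simp) hne hdvd
  have hsep : (X ^ q - X : E[X]).Separable := by
    apply galois_poly_separable p
    rw [hqp]; exact dvd_pow_self _ hk.ne'
  have hW0 : (X ^ q - X : E[X]) ≠ 0 := FiniteField.X_pow_card_sub_X_ne_zero E hq1
  apply hspl.dvd_of_roots_le_roots hW0
  rw [Multiset.le_iff_subset (Polynomial.nodup_roots hsep)]
  intro t ht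
  rw [mem_roots hW0] at ht
  rw [mem_roots hP0]
  exact hP t (by simpa [IsRoot, sub_eq_zero] using ht)

open Polynomial in
theorem aux_coeff6 {E : Type*} [Field E] (c6 c5 c4 c3 c2 c1 c0 : E)
    (h : C c6 * X ^ 6 + C c5 * X ^ 5 + C c4 * X ^ 4 + C c3 * X ^ 3 + C c2 * X ^ 2 + C c1 * X + C c0
      = (0 : E[X])) : c6 = 0 ∧ c5 = 0 ∧ c4 = 0 ∧ c3 = 0 ∧ c2 = 0 := by
  refine ⟨?_, ?_, ?_, ?_, ?_⟩
  · simpa [coeff_X, coeff_C] using congrArg (fun P => P.coeff 6) h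
  · simpa [coeff_X, coeff_C] using congrArg (fun P => P.coeff 5) h
  · simpa [coeff_X, coeff_C] using congrArg (fun P => P.coeff 4) h
  · simpa [coeff_X, coeff_C] using congrArg (fun P => P.coeff 3) h
  · simpa [coeff_X, coeff_C] using congrArg (fun P => P.coeff 2) h

open Polynomial in
theorem aux_coeff {E : Type*} [Field E] (h2 : (2 : E) ≠ 0) (g4 g2 g1 g0 m2 m1 m0 : E) (h4 : g4 ≠ 0)
    (e4 : 2 * (C g4 * X ^ 4 + C g2 * X ^ 2 + C g1 * X + C g0) * (C (12 * g4) * X ^ 2 + C (2 * g2)) -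
      4 * (C g4 * X ^ 4 + C g2 * X ^ 2 + C g1 * X + C g0) * (C m2 * X ^ 2 + C m1 * X + C m0) -
      (C (4 * g4) * X ^ 3 + C (2 * g2) * X + C g1) ^ 2 = (0 : E[X])) :
    g1 = 0 ∧ g2 ^ 2 = 4 * g4 * g0 := by
  have e5 : C (24 * g4 ^ 2 - 4 * g4 * m2 - 16 * g4 ^ 2) * X ^ 6 + C (-4 * g4 * m1) * X ^ 5
     + C (28 * g4 * g2 - 4 * g4 * m0 - 4 * g2 * m2 - 16 * g4 * g2) * X ^ 4
     + C (24 * g4 * g1 - 4 * g2 * m1 - 4 * g1 * m2 - 8 * g4 * g1) * X ^ 3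
     + C (24 * g4 * g0 + 4 * g2 ^ 2 - 4 * g2 * m0 - 4 * g1 * m1 - 4 * g0 * m2 - 4 * g2 ^ 2) * X ^ 2
     + C (4 * g1 * g2 - 4 * g1 * m0 - 4 * g0 * m1 - 4 * g2 * g1) * X
     + C (4 * g0 * g2 - 4 * g0 * m0 - g1 ^ 2) = (0 : E[X]) := by
    rw [← e4]
    simp only [map_sub, map_add, map_mul, map_pow, map_neg, map_ofNat]
    ring
  obtain ⟨c6, c5, c4, c3, c2⟩ := aux_coeff6 _ _ _ _ _ _ _ e5
  have h4' : (4 : E) ≠ 0 := by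
    have : (4 : E) = 2 * 2 := by norm_num
    rw [this]; exact mul_ne_zero h2 h2
  have hm2 : m2 = 2 * g4 := by
    have : (4 * g4) * (m2 - 2 * g4) = 0 := by linear_combination - c6
    exact sub_eq_zero.1 ((mul_eq_zero.1 this).resolve_left (mul_ne_zero h4' h4))
  have hm1 : m1 = 0 := by
    have : (4 * g4) * m1 = 0 := by linear_combination - c5
    exact (mul_eq_zero.1 this).resolve_left (mul_ne_zero h4' h4)
  subst hm2 hm1
  have hm0 : m0 = g2 := by
    have : (4 * g4) * (m0 - g2) = 0 := by linear_combination - c4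
    exact sub_eq_zero.1 ((mul_eq_zero.1 this).resolve_left (mul_ne_zero h4' h4))
  subst hm0
  refine ⟨?_, ?_⟩
  · have : (4 * g4) * (2 * g1) = 0 := by linear_combination c3
    have := ((mul_eq_zero.1 this).resolve_left (mul_ne_zero h4' h4))
    exact (mul_eq_zero.1 this).resolve_left h2
  · have : 4 * (m0 ^ 2 - 4 * g4 * g0) = 0 := by linear_combination - c2
    exact sub_eq_zero.1 ((mul_eq_zero.1 this).resolve_left h4')

open Polynomial in
theorem aux_big {E : Type*} [Field E] [Fintype E] (p k q : ℕ) [hp : Fact p.Prime] [CharP E p] (hk : 0 < k)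
   (hqp : q = p ^ k) (hodd : Odd q) (hE : Fintype.card E = q ^ 4) (h7 : 7 ≤ q) (h2 : (2 : E) ≠ 0)
   (g4 g2 g1 g0 : E) (h4 : g4 ≠ 0)
   (hg : ∀ t : E, t ^ q = t → (g4 * t ^ 4 + g2 * t ^ 2 + g1 * t + g0) ^ ((q - 1) / 2) = 1) :
   g1 = 0 ∧ g2 ^ 2 = 4 * g4 * g0 := by
  obtain ⟨n, hn⟩ := hodd
  have hn' : (q - 1) / 2 = n := by omega
  rw [hn'] at hg
  set g : E[X] := C g4 * X ^ 4 + C g2 * X ^ 2 + C g1 * X + C g0 with hgdef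
  have hgd : g.natDegree = 4 := by rw [hgdef]; compute_degree!
  have hPd : (g ^ n - 1).natDegree = 4 * n := by
    rw [← C_1, natDegree_sub_C, natDegree_pow, hgd, mul_comm]
  have hP0 : g ^ n - 1 ≠ 0 := by
    intro h; rw [h, natDegree_zero] at hPd; omega
  obtain ⟨h, hh⟩ := aux_dvd p k q hk hqp hE (g ^ n - 1) hP0 (by
    intro t ht
    simp [hgdef, hg t ht])
  set W : E[X] := X ^ q - X with hW
  have hWd : W.natDegree = q := FiniteField.X_pow_card_sub_X_natDegree_eq E (by omega)
  have hW0 : W ≠ 0 := by intro h; rw [h, natDegree_zero] at hWd; omega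
  have hh0 : h ≠ 0 := by rintro rfl; simp [hP0] at hh
  have hhd : q + h.natDegree = 4 * n := by
    rw [← hPd, hh, natDegree_mul hW0 hh0, hWd]
  have hq0 : (q : E[X]) = 0 := by
    rw [hqp, Nat.cast_pow, CharP.cast_eq_zero, zero_pow hk.ne']
  have hW' : derivative W = -1 := by
    rw [hW, derivative_sub, derivative_X_pow, derivative_X]
    have : (C (q : E) : E[X]) = 0 := by rw [← hq0]; simp
    rw [this]; ring
  have hnn : (2 * n + 1 : E[X]) = 0 := by rw [← hq0, hn]; push_cast; ring
  have hP' : 2 * g * derivative (g ^ n - 1) = - derivative g * g ^ n := by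
    obtain ⟨l, rfl⟩ : ∃ l, n = l + 1 := ⟨n - 1, by omega⟩
    simp only [derivative_sub, derivative_one, derivative_pow, Nat.add_sub_cancel]
    push_cast at hnn ⊢
    simp only [map_add, map_natCast, map_one]
    linear_combination (derivative g * g ^ (l + 1)) * hnn
  have e1 : W * (2 * g * derivative h + derivative g * h) = 2 * g * h - derivative g := by
    have e : g ^ n = 1 + W * h := by rw [← hh]; ring
    rw [hh, derivative_mul, hW', e] at hP'
    linear_combination hP'
  set m := 2 * g * derivative h + derivative g * h with hm
  have e2 : derivative W * m + W * derivative m = 2 * derivative g * h + 2 * g * derivative h - derivative (derivative g) := by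
    have := congrArg derivative e1
    simp only [derivative_mul, derivative_sub, derivative_ofNat] at this
    linear_combination this
  rw [hW'] at e2
  have e3 : W * (derivative g * m - 2 * g * derivative m) =
      2 * g * derivative (derivative g) - 4 * g * m - derivative g ^ 2 := by
    linear_combination (derivative g) * e1 - 2 * g * e2 + (2 * g) * hm
  have hg'd : (derivative g).natDegree ≤ 3 := by
    have := natDegree_derivative_le g; omega
  have hg''d : (derivative (derivative g)).natDegree ≤ 2 := by
    have := natDegree_derivative_le (derivative g); omega
  have hmd : m.natDegree ≤ 2 := by
    by_cases hm0 : m = 0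
    · simp [hm0]
    have h1 : (W * m).natDegree = q + m.natDegree := by rw [natDegree_mul hW0 hm0, hWd]
    have h2 : (2 * g * h - derivative g).natDegree ≤ 4 + h.natDegree := by
      refine (natDegree_sub_le_of_le (m := 4 + h.natDegree) (n := 3) ?_ ?_).trans (by omega)
      · rw [mul_assoc, ← C_ofNat]
        refine (natDegree_C_mul_le _ _).trans (natDegree_mul_le.trans (by omega))
      · omega
    rw [← e1, h1] at h2
    omega
  have e4 : 2 * g * derivative (derivative g) - 4 * g * m - derivative g ^ 2 = 0 := by
    have hd : (2 * g * derivative (derivative g) - 4 * g * m - derivative g ^ 2).natDegree ≤ 6 := by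
      refine (natDegree_sub_le_of_le (m := 6) (n := 6) ?_ ?_).trans (by omega)
      · refine (natDegree_sub_le_of_le (m := 6) (n := 6) ?_ ?_).trans (by omega)
        · rw [mul_assoc, ← C_ofNat]
          refine (natDegree_C_mul_le _ _).trans (natDegree_mul_le.trans (by omega))
        · rw [mul_assoc, ← C_ofNat]
          refine (natDegree_C_mul_le _ _).trans (natDegree_mul_le.trans (by omega))
      · exact natDegree_pow_le.trans (by omega)
    rw [← e3] at hd ⊢
    by_contra hne
    rw [natDegree_mul hW0 (right_ne_zero_of_mul hne), hWd] at hd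
    omega
  have hme : m = C (m.coeff 2) * X ^ 2 + C (m.coeff 1) * X + C (m.coeff 0) := 
    eq_quadratic_of_degree_le_two (natDegree_le_iff_degree_le.1 hmd)
  generalize m.coeff 2 = m2 at hme
  generalize m.coeff 1 = m1 at hme
  generalize m.coeff 0 = m0 at hme
  have hg' : derivative g = C (4 * g4) * X ^ 3 + C (2 * g2) * X + C g1 := by
    rw [hgdef]; simp only [derivative_add, derivative_C_mul_X_pow, derivative_C_mul_X, derivative_C, map_mul, map_ofNat, Nat.cast_ofNat]; ring
  have hg'' : derivative (derivative g) = C (12 * g4) * X ^ 2 + C (2 * g2) := by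
    rw [hg']; simp only [derivative_add, derivative_C_mul_X_pow, derivative_C_mul_X, derivative_C]; simp only [map_mul, map_ofNat, Nat.cast_ofNat]; ring
  rw [hg'', hg', hme, hgdef] at e4
  exact aux_coeff h2 g4 g2 g1 g0 m2 m1 m0 h4 e4

theorem aux_key {E : Type*} [Field E] [Fintype E] (p k q : ℕ) [hp : Fact p.Prime] [CharP E p] (hk : 0 < k)
   (hqp : q = p ^ k) (hodd : Odd q) (hE : Fintype.card E = q ^ 4) (h2 : (2 : E) ≠ 0)
   (D s a b : E) (hD : D ^ q = D) (hs : s ^ q = s) (ha : a ^ q = a) (hb : b ^ q = b) (hD0 : D ≠ 0)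
   (hD2 : ∀ t : E, t ^ q = t → t ^ 2 ≠ D) (hab : ¬ (a = 0 ∧ b = 0))
   (hg : ∀ t : E, t ^ q = t → ∃ N : E, N ^ q = N ∧ N ≠ 0 ∧
     (D * t ^ 2 + s ^ 2 - 4 * a) ^ 2 - D * (2 * s * t - 4 * b) ^ 2 = N ^ 2) :
   s = 0 ∧ b = 0 := by
  have hg' : ∀ t : E, t ^ q = t →
     ((D * t ^ 2 + s ^ 2 - 4 * a) ^ 2 - D * (2 * s * t - 4 * b) ^ 2) ^ ((q - 1) / 2) = 1 := by
    intro t ht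
    obtain ⟨N, hN, hN0, e⟩ := hg t ht
    obtain ⟨n, hn⟩ := hodd
    have hn' : (q - 1) / 2 = n := by omega
    rw [e, hn', ← pow_mul]
    apply mul_right_cancel₀ hN0
    rw [← pow_succ, ← hn, hN, one_mul]
  by_cases h7 : 7 ≤ q
  · have h4 : (4 : E) ≠ 0 := by
      have : (4 : E) = 2 * 2 := by norm_num
      rw [this]; exact mul_ne_zero h2 h2
    obtain ⟨k1, k2⟩ := aux_big p k q hk hqp hodd hE h7 h2 (D ^ 2)
      (2 * D * (s ^ 2 - 4 * a) - 4 * D * s ^ 2) (16 * D * s * b)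
      ((s ^ 2 - 4 * a) ^ 2 - 16 * D * b ^ 2) (pow_ne_zero 2 hD0) (by
        intro t ht
        rw [← hg' t ht]; congr 1; ring)
    have k3 : (4 * 4 * D) * (s * b) = 0 := by linear_combination k1
    have k4 := (mul_eq_zero.1 k3).resolve_left (mul_ne_zero (mul_ne_zero h4 h4) hD0)
    have k5 : (4 * 4 * D ^ 2) * (4 * (a * s ^ 2) + 4 * D * b ^ 2) = 0 := by
      rcases mul_eq_zero.1 k4 with h | h
      · subst h; linear_combination k2
      · subst h; linear_combination k2
    have k6 := (mul_eq_zero.1 k5).resolve_left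
      (mul_ne_zero (mul_ne_zero h4 h4) (pow_ne_zero 2 hD0))
    rcases mul_eq_zero.1 k4 with h | h
    · refine ⟨h, ?_⟩
      subst h
      have : (4 * D) * b ^ 2 = 0 := by linear_combination k6
      exact pow_eq_zero_iff (two_ne_zero) |>.1 ((mul_eq_zero.1 this).resolve_left (mul_ne_zero h4 hD0))
    · refine ⟨?_, h⟩
      subst h
      have : a * s ^ 2 = 0 :=
        (mul_eq_zero.1 (show 4 * (a * s ^ 2) = 0 by linear_combination k6)).resolve_left h4
      rcases mul_eq_zero.1 this with h | h
      · exact absurd ⟨h, rfl⟩ hab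
      · exact pow_eq_zero_iff (two_ne_zero) |>.1 h
  · have h35 : q = 3 ∨ q = 5 := by
      have : 1 < q := hqp ▸ Nat.one_lt_pow hk.ne' hp.out.one_lt
      obtain ⟨n, hn⟩ := hodd
      omega
    have hpq : p = q := by
      have hqprime : q.Prime := by rcases h35 with rfl | rfl <;> norm_num
      rw [hqp] at hqprime
      have := (Nat.Prime.eq_one_of_pow hqprime)
      rw [hqp, this, pow_one]
    subst hpq
    exact aux_small p h35 D s a b hD hs ha hb hD2 hab hg'


/-- for odd `q` and `L(X) = a_1 X^{q^2} + a_0 X` over `F_{q^4}` with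
`a_1 ≠ 0`, `Tr_{q^4/q}(L(x)/x) ≠ 0` for all nonzero `x` iff `a_1^{q^2+1}` is a nonzero
square in the subfield `F_q = {d : d^q = d}` and `Tr_{q^4/q}(a_0) = 0`. -/
theorem stmt_6 (q : ℕ) (hq : ∃ p k : ℕ, p.Prime ∧ Odd p ∧ 0 < k ∧ q = p ^ k)
    (E : Type*) [Field E] [Fintype E] (hE : Fintype.card E = q ^ 4)
    (a0 a1 : E) (ha1 : a1 ≠ 0) :
    (∀ x : E, x ≠ 0 →
        ∑ j ∈ Finset.range 4, ((a1 * x ^ q ^ 2 + a0 * x) / x) ^ q ^ j ≠ 0)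
      ↔ ((∃ d : E, d ^ q = d ∧ d ≠ 0 ∧ a1 ^ (q ^ 2 + 1) = d ^ 2) ∧
          ∑ j ∈ Finset.range 4, a0 ^ q ^ j = 0) := by
  obtain ⟨p, k, hp, hpodd, hk, hqp⟩ := hq
  have : Fact p.Prime := ⟨hp⟩
  have hodd : Odd q := hqp ▸ hpodd.pow
  have hcE : Fintype.card E = p ^ (k * 4) := by rw [hE, hqp, pow_mul]
  have : CharP E p := charP_of_card_eq_prime_pow hcE
  have hrc : ringChar E ≠ 2 := by
    rw [ringChar.eq E p]
    rintro rfl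
    exact absurd hpodd (by decide)
  have h2 : (2 : E) ≠ 0 := Ring.two_ne_zero hrc
  have h4 : (4 : E) ≠ 0 := by
    have : (4 : E) = 2 * 2 := by norm_num
    rw [this]; exact mul_ne_zero h2 h2
  obtain ⟨φ, hφ⟩ : ∃ φ : E →+* E, ∀ x, x ^ q = φ x :=
    ⟨iterateFrobenius E p k, fun x => by rw [iterateFrobenius_def, hqp]⟩
  have hφ2 : ∀ x, x ^ q ^ 2 = φ (φ x) := fun x => by rw [pow_two, pow_mul, hφ, hφ]
  have hφ3 : ∀ x, x ^ q ^ 3 = φ (φ (φ x)) := fun x => by rw [pow_succ, pow_mul, hφ2, hφ]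
  have hφ4 : ∀ x, φ (φ (φ (φ x))) = x := fun x => by
    rw [← hφ3, ← hφ, ← pow_mul, ← pow_succ', ← hE, FiniteField.pow_card]
  have hsum : ∀ z : E, ∑ j ∈ Finset.range 4, z ^ q ^ j = z + φ z + φ (φ z) + φ (φ (φ z)) := by
    intro z
    simp only [Finset.sum_range_succ, Finset.sum_range_zero, hφ2, hφ3, pow_zero, pow_one, hφ]
    ring
  have hNa : a1 ^ (q ^ 2 + 1) = a1 * φ (φ a1) := by rw [pow_succ, hφ2, mul_comm]
  have hpm : ∀ x y : E, x ^ 2 = y ^ 2 → x = y ∨ x = - y := fun x y h => sq_eq_sq_iff_eq_or_eq_neg.1 h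
  simp only [hsum, hφ2, hφ, hNa]
  have hq1 : 1 < q := hqp ▸ Nat.one_lt_pow hk.ne' hp.one_lt
  have hφ0 : ∀ x, x ≠ 0 → φ x ≠ 0 := fun x hx => (map_ne_zero φ).2 hx
  constructor
  · intro H
    -- arithmetic of exponents
    obtain ⟨n, hn⟩ := hodd
    have hc2 : Fintype.card E / 2 = (2 * n ^ 2 + 2 * n + 1) * (q ^ 2 - 1) := by
      have e1 : q ^ 2 - 1 = 4 * n ^ 2 + 4 * n := by
        rw [hn]; apply Nat.sub_eq_of_eq_add; ring
      have e2 : q ^ 4 = 2 * ((2 * n ^ 2 + 2 * n + 1) * (4 * n ^ 2 + 4 * n)) + 1 := by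
        rw [hn]; ring
      rw [hE, e1, e2]; omega
    have hc1 : q ^ 2 - 1 = (q + 1) * (q - 1) := by
      simpa using Nat.sq_sub_sq q 1
    obtain ⟨γ, hγ⟩ := FiniteField.exists_nonsquare (F := E) hrc
    have hγ0 : γ ≠ 0 := by rintro rfl; exact hγ (IsSquare.zero)
    have hγ1 : γ ^ (Fintype.card E / 2) = -1 := 
      (FiniteField.pow_dichotomy hrc hγ0).resolve_left
        (fun h => hγ ((FiniteField.isSquare_iff hrc hγ0).2 h))
    obtain ⟨ε, hε0, hε⟩ : ∃ ε : E, ε ≠ 0 ∧ φ (φ ε) = - ε := by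
      refine ⟨γ ^ (2 * n ^ 2 + 2 * n + 1), pow_ne_zero _ hγ0, ?_⟩
      rw [hc2, pow_mul] at hγ1
      rw [← hφ2, ← Nat.sub_add_cancel (Nat.one_le_pow 2 q (by omega)), pow_succ, hγ1]; ring
    obtain ⟨δ, hδ0, hδ⟩ : ∃ δ : E, δ ≠ 0 ∧ φ δ = - δ := by
      refine ⟨γ ^ ((2 * n ^ 2 + 2 * n + 1) * (q + 1)), pow_ne_zero _ hγ0, ?_⟩
      rw [hc2, hc1, ← mul_assoc, pow_mul] at hγ1
      have e : ∀ z : E, z ^ (q - 1) = -1 → φ z = - z := by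
        intro z hz
        rw [← hφ, ← Nat.sub_add_cancel hq1.le, pow_succ, hz]; ring
      exact e _ hγ1
    -- Hilbert 90
    have H1 : ∀ y : E, y * φ (φ y) = a1 * φ (φ a1) →
        y + φ y + φ (φ y) + φ (φ (φ y)) + (a0 + φ a0 + φ (φ a0) + φ (φ (φ a0))) ≠ 0 := by
      intro y hy
      obtain ⟨x, hx0, hx⟩ : ∃ x : E, x ≠ 0 ∧ a1 * φ (φ x) = y * x := by
        have ha1' : φ (φ a1) ≠ 0 := hφ0 _ (hφ0 _ ha1)
        by_cases hya : y = - a1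
        · exact ⟨ε, hε0, by rw [hε, hya]; ring⟩
        · refine ⟨1 + φ (φ (y / a1)), ?_, ?_⟩
          · have e1 : 1 + φ (φ (y / a1)) = φ (φ (1 + y / a1)) := by simp only [map_add, map_one]
            rw [e1]
            apply hφ0 _ (hφ0 _ _)
            intro h; field_simp at h; exact hya (by linear_combination h)
          · simp only [map_add, map_one, hφ4, map_div₀]
            field_simp
            linear_combination -hy
      have h := H x hx0
      have e : (a1 * φ (φ x) + a0 * x) / x = y + a0 := by
        rw [hx]; field_simp
      rw [e] at h
      simp only [map_add] at h
      intro h'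
      apply h
      linear_combination h'
    set T := a0 + φ a0 + φ (φ a0) + φ (φ (φ a0)) with hT
    have hTφ : φ T = T := by rw [hT]; simp only [map_add, hφ4]; ring
    set A := a1 * φ (φ a1) with hA
    have hA0 : A ≠ 0 := mul_ne_zero ha1 (hφ0 _ (hφ0 _ ha1))
    have hAφ : φ (φ A) = A := by rw [hA]; simp only [map_mul, hφ4]; ring
    -- squares
    have H2 : ∀ e : E, φ (φ e) = e → IsSquare e := by
      intro e he
      by_cases he0 : e = 0
      · rw [he0]; exact IsSquare.zero
      rw [FiniteField.isSquare_iff hrc he0, hc2, mul_comm, pow_mul]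
      have : e ^ (q ^ 2 - 1) = 1 := by
        apply mul_right_cancel₀ he0
        rw [← pow_succ, Nat.sub_add_cancel (Nat.one_le_pow 2 q (by omega)), hφ2, he, one_mul]
      rw [this, one_pow]
    have H3 : ∀ s : E, φ (φ s) = s → s + φ s = - T → ∃ N : E, φ N = N ∧ N ≠ 0 ∧
        (s ^ 2 - 4 * A) * φ (s ^ 2 - 4 * A) = N ^ 2 := by
      intro s hs hsT
      obtain ⟨w, hw⟩ := H2 (s ^ 2 - 4 * A) (by
        simp only [map_sub, map_mul, map_pow, hs, hAφ, map_ofNat])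
      have hw2 : φ (φ w) ^ 2 = w ^ 2 := by
        have : w ^ 2 = s ^ 2 - 4 * A := by rw [hw]; ring
        rw [← map_pow, ← map_pow, this]
        simp only [map_sub, map_mul, map_pow, hs, hAφ, map_ofNat]
      have hneg : φ (φ w) ≠ - w := by
        intro hw'
        have e1 : φ (φ ((s + w) / 2)) = (s - w) / 2 := by
          simp only [map_div₀, map_add, hs, hw', map_ofNat]; ring
        apply H1 ((s + w) / 2)
        · rw [e1]
          field_simp
          linear_combination hw
        · rw [e1]
          simp only [map_div₀, map_add, map_sub, map_ofNat]
          field_simp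
          linear_combination 2 * hsT
      have hw' := (hpm _ _ hw2).resolve_right hneg
      have hw0 : w ≠ 0 := by rintro rfl; simp at hneg
      refine ⟨w * φ w, by rw [map_mul, hw', mul_comm], mul_ne_zero hw0 (hφ0 _ hw0), ?_⟩
      rw [hw, map_mul]; ring
    set D := δ ^ 2 with hD
    have hDφ : φ D = D := by rw [hD, map_pow, hδ]; ring
    set a := (A + φ A) / 2 with ha
    set b := (A - φ A) / (2 * δ) with hb
    set s := - T / 2 with hs
    have haφ : φ a = a := by
      rw [ha]; simp only [map_div₀, map_add, hAφ, map_ofNat]; ring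
    have hbφ : φ b = b := by
      rw [hb]; simp only [map_div₀, map_sub, map_mul, hAφ, map_ofNat, hδ]; field_simp; ring
    have hsφ : φ s = s := by
      rw [hs]; simp only [map_div₀, map_neg, hTφ, map_ofNat]
    have hAab : A = a + b * δ := by rw [ha, hb]; field_simp; ring
    have hAab' : φ A = a - b * δ := by rw [ha, hb]; field_simp; ring
    have hgN : ∀ t : E, t ^ q = t → ∃ N : E, N ^ q = N ∧ N ≠ 0 ∧
       (D * t ^ 2 + s ^ 2 - 4 * a) ^ 2 - D * (2 * s * t - 4 * b) ^ 2 = N ^ 2 := by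
      intro t ht
      rw [hφ] at ht
      obtain ⟨N, hN, hN0, e⟩ := H3 (s + t * δ)
        (by simp only [map_add, map_mul, hsφ, ht, hδ, map_neg]; ring)
        (by simp only [map_add, map_mul, hsφ, ht, hδ]; rw [hs]; field_simp; ring)
      refine ⟨N, by rw [hφ, hN], hN0, ?_⟩
      rw [← e]
      simp only [map_sub, map_mul, map_pow, map_add, hsφ, ht, hδ, map_ofNat]
      rw [hAab', hAab, hD]; ring
    obtain ⟨hs0, hb0⟩ := aux_key p k q hk hqp ⟨n, hn⟩ hE h2 D s a b (by rw [hφ, hDφ])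
      (by rw [hφ, hsφ]) (by rw [hφ, haφ]) (by rw [hφ, hbφ]) (pow_ne_zero 2 hδ0)
      (by
        intro t ht h
        rw [hφ] at ht
        have : t = 0 := by
          rcases hpm t δ h with h | h
          · rw [h, hδ] at ht
            have : (2 : E) * t = 0 := by rw [h]; linear_combination - ht
            exact (mul_eq_zero.1 this).resolve_left h2
          · rw [h, map_neg, hδ] at ht
            have : (2 : E) * t = 0 := by rw [h]; linear_combination - ht
            exact (mul_eq_zero.1 this).resolve_left h2
        rw [this] at h
        exact pow_ne_zero 2 hδ0 (by rw [← hD, ← h]; ring))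
      (by
        rintro ⟨h, h'⟩
        apply hA0; rw [hAab, h, h']; ring) hgN
    have hAa : A = a := by rw [hAab, hb0]; ring
    refine ⟨?_, ?_⟩
    · obtain ⟨r, hr⟩ := H2 A hAφ
      have hr2 : (φ r) ^ 2 = r ^ 2 := by
        have : r ^ 2 = a := by rw [← hAa, hr]; ring
        rw [← map_pow, this, haφ]
      rcases hpm _ _ hr2 with h | h
      · refine ⟨r, h, ?_, by rw [hr]; ring⟩
        rintro rfl
        exact hA0 (by rw [hr]; ring)
      · exfalso
        obtain ⟨N, -, hN0, e⟩ := hgN (2 * r / δ) (by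
          rw [hφ]; simp only [map_div₀, map_mul, map_ofNat, h, hδ]; field_simp)
        apply hN0
        have e' : D * (2 * r / δ) ^ 2 = 4 * a := by
          rw [hD, ← hAa, hr]; field_simp; ring
        rw [e', hs0, hb0] at e
        exact pow_eq_zero_iff (two_ne_zero) |>.1 (by rw [← e]; ring)
    · have : T = -2 * s := by rw [hs]; field_simp
      rw [this, hs0]; ring
  · rintro ⟨⟨d, hd, hd0, hA⟩, hT⟩ x hx0 h
    set y := a1 * φ (φ x) / x with hy
    have e : (a1 * φ (φ x) + a0 * x) / x = y + a0 := by rw [hy]; field_simp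
    rw [e] at h
    simp only [map_add] at h
    have hN : y * φ (φ y) = d ^ 2 := by
      have hx2 := hφ0 _ (hφ0 _ hx0)
      rw [← hA, hy]
      simp only [map_div₀, map_mul, hφ4]
      field_simp
    have hyT : y + φ y + φ (φ y) + φ (φ (φ y)) = 0 := by linear_combination h - hT
    have hsq : (y + φ (φ y)) ^ 2 - 4 * d ^ 2 = (y - φ (φ y)) ^ 2 := by linear_combination 4 * hN
    have hsφ : φ (y + φ (φ y)) = - (y + φ (φ y)) := by
      rw [map_add]; linear_combination hyT
    have hw2 : (φ (y - φ (φ y))) ^ 2 = (y - φ (φ y)) ^ 2 := by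
      rw [← map_pow, ← hsq]
      rw [map_sub, map_pow, hsφ, map_mul, map_pow, hd, map_ofNat]; ring
    have hw : φ (φ (y - φ (φ y))) = y - φ (φ y) := by
      rcases hpm _ _ hw2 with h | h
      · rw [h, h]
      · rw [h, map_neg, h, neg_neg]
    have hw0 : y - φ (φ y) = 0 := by
      rw [map_sub, map_sub, hφ4] at hw
      have : 2 * (y - φ (φ y)) = 0 := by linear_combination - hw
      exact (mul_eq_zero.1 this).resolve_left h2
    rw [hw0] at hsq
    have hs2 : (y + φ (φ y)) ^ 2 = (2 * d) ^ 2 := by linear_combination hsq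
    have h2d : φ (2 * d) = 2 * d := by rw [map_mul, map_ofNat, hd]
    have : 4 * d = 0 := by
      rcases hpm _ _ hs2 with h | h
      · rw [h, h2d] at hsφ; linear_combination hsφ
      · rw [h, map_neg, h2d] at hsφ; linear_combination - hsφ
    exact hd0 ((mul_eq_zero.1 this).resolve_left h4)
end

section
/- Let p be a prime and let n be an integer with n ≥ (p−1)(p^2−p+4)/2. Let L(X) = Σ_{i=0}^{n-1} a_i X^{p^i} with a_i ∈ F_{p^n}. If Tr_{p^n/p}(L(x)/x) ≠ 0 for every nonzero x ∈ F_{p^n}, then a_1 = a_2 = ⋯ = a_{n−1} = 0, i.e., L(X) = a_0 X. -/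
open Multiset

def ww (p : ℕ) {n : ℕ} (s : Multiset (Fin n)) : ℕ := (s.map (fun i : Fin n => p ^ (i : ℕ))).sum

theorem ww_eq (p : ℕ) {n : ℕ} (s : Multiset (Fin n)) : ww p s = ∑ i, s.count i * p ^ (i:ℕ) := by
  unfold ww
  rw [Finset.sum_multiset_map_count]
  simp only [smul_eq_mul]
  apply Finset.sum_subset (Finset.subset_univ _)
  intro x _ hx
  simp at hx
  simp [hx]

theorem ww_add (p : ℕ) {n : ℕ} (s t : Multiset (Fin n)) : ww p (s + t) = ww p s + ww p t := by
  simp [ww]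

theorem ww_lt (p n : ℕ) (hp : 2 ≤ p) (hn : 3 ≤ n) (s : Multiset (Fin n))
    (hs : ∀ i, s.count i < p) (hc : s.card ≤ 2 * (p - 1)) : ww p s < p ^ n - 1 := by
  have hgeo : ∑ i : Fin n, (p-1) * p ^ (i:ℕ) = p ^ n - 1 := by
    rw [← Finset.mul_sum, Fin.sum_univ_eq_sum_range (fun i => p ^ i), Nat.geomSum_eq hp,
      Nat.mul_div_cancel' (Nat.sub_one_dvd_pow_sub_one p n)]
  rw [ww_eq, ← hgeo]
  have hex : ∃ i, s.count i < p - 1 := by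
    by_contra! hcon
    have h1 : ∑ i, s.count i = s.card := by
      simp
    have h2 : ∑ i : Fin n, (p - 1) ≤ ∑ i, s.count i := Finset.sum_le_sum (fun i _ => hcon i)
    simp at h2
    have : 3 * (p - 1) ≤ n * (p - 1) := Nat.mul_le_mul_right _ hn
    omega
  obtain ⟨i, hi⟩ := hex
  apply Finset.sum_lt_sum
  · intro j _
    exact Nat.mul_le_mul_right _ (by have := hs j; omega)
  · exact ⟨i, Finset.mem_univ _, Nat.mul_lt_mul_of_pos_right hi (by positivity)⟩

theorem canon (p n : ℕ) (hp : 2 ≤ p) (hn : 3 ≤ n) (s s' : Multiset (Fin n))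
    (hs : ∀ i, s.count i < p) (hs' : ∀ i, s'.count i < p)
    (hc : s.card ≤ 2 * (p - 1)) (hc' : s'.card ≤ 2 * (p - 1))
    (h : ww p s ≡ ww p s' [MOD p ^ n - 1]) : s = s' := by
  have h1 := ww_lt p n hp hn s hs hc
  have h2 := ww_lt p n hp hn s' hs' hc'
  have h3 := Nat.ModEq.eq_of_lt_of_lt h h1 h2
  rw [ww_eq, ww_eq] at h3
  have h4 : (finFunctionFinEquiv (fun i => (⟨s.count i, hs i⟩ : Fin p)))
     = finFunctionFinEquiv (fun i => (⟨s'.count i, hs' i⟩ : Fin p)) := by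
    apply Fin.ext
    rw [finFunctionFinEquiv_apply, finFunctionFinEquiv_apply]
    exact h3
  have h5 := finFunctionFinEquiv.injective h4
  ext i
  have := congrFun h5 i
  simpa using this

theorem pow_modEq (p n : ℕ) (hp : 2 ≤ p) (a : ℕ) : p ^ (a % n) ≡ p ^ a [MOD p ^ n - 1] := by
  have h1 : p ^ n ≡ 1 [MOD p ^ n - 1] := by
    have := Nat.one_le_pow n p (by omega)
    exact ((Nat.modEq_iff_dvd' this).2 dvd_rfl).symm
  conv_rhs => rw [← Nat.mod_add_div a n, pow_add, pow_mul]
  simpa using ((h1.pow (a / n)).mul_left (p ^ (a % n))).symm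

theorem carry (p n : ℕ) [NeZero n] (hp : 2 ≤ p) (s : Multiset (Fin n))
    (hc : s.card = 2 * (p - 1)) : (∀ i, s.count i < p) ∨ ∃ l r, s = replicate p l + r ∧
      (∀ i, ((l + 1) ::ₘ r).count i < p) ∧ ((l + 1) ::ₘ r).card = p - 1 ∧
      ww p ((l + 1) ::ₘ r) ≡ ww p s [MOD p ^ n - 1] := by
  by_cases h : ∀ i, s.count i < p
  · exact Or.inl h
  right
  push Not at h
  obtain ⟨l, hl⟩ := h
  obtain ⟨r, rfl⟩ := Multiset.le_iff_exists_add.1 (Multiset.le_count_iff_replicate_le.1 hl)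
  have hcard : ((l + 1) ::ₘ r).card = p - 1 := by
    simp at hc ⊢
    omega
  refine ⟨l, r, rfl, ?_, hcard, ?_⟩
  · intro i
    have := Multiset.count_le_card i ((l + 1) ::ₘ r)
    omega
  · rw [ww_add, ← Multiset.singleton_add, ww_add]
    apply Nat.ModEq.add_right
    simp only [ww, map_singleton, sum_singleton, map_replicate, sum_replicate, smul_eq_mul]
    rw [← pow_succ', Fin.val_add]
    refine (pow_modEq p n hp _).trans ?_
    rcases Nat.lt_or_ge 1 n with h1 | h1
    · have : ((1 : Fin n) : ℕ) = 1 := by rw [Fin.val_one', Nat.mod_eq_of_lt h1]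
      rw [this]
    · have : n = 1 := by have := NeZero.ne n; omega
      subst this
      refine (pow_modEq p 1 hp _).symm.trans (Nat.ModEq.trans ?_ (pow_modEq p 1 hp _))
      rw [Nat.mod_one, Nat.mod_one]

theorem uniqU (p n : ℕ) [NeZero n] (hp : 2 ≤ p) (hn : 3 ≤ n) (s s' : Multiset (Fin n))
    (hc : s.card = 2 * (p - 1)) (hc' : s'.card = 2 * (p - 1))
    (h : ww p s ≡ ww p s' [MOD p ^ n - 1]) :
    s = s' ∨ ∃ l r l' r', s = replicate p l + r ∧ s' = replicate p l' + r' ∧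
      (l + 1) ::ₘ r = (l' + 1) ::ₘ r' := by
  rcases carry p n hp s hc with h1 | ⟨l, r, e1, h1, k1, m1⟩ <;>
  rcases carry p n hp s' hc' with h2 | ⟨l', r', e2, h2, k2, m2⟩
  · exact Or.inl (canon p n hp hn s s' h1 h2 hc.le hc'.le h)
  · have := canon p n hp hn s _ h1 h2 hc.le (by omega) (h.trans m2.symm)
    have := congrArg card this
    omega
  · have := canon p n hp hn _ s' h1 h2 (by omega) hc'.le (m1.trans h)
    have := congrArg card this
    omega
  · right
    exact ⟨l, r, l', r', e1, e2, canon p n hp hn _ _ h1 h2 (by omega) (by omega)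
      (m1.trans (h.trans m2.symm))⟩

/-- carry in nodup `J` plus `I'` of size `p-1`. -/
theorem carry_nodup (p n : ℕ) (hp : 2 ≤ p) (J I' r : Multiset (Fin n)) (l : Fin n)
    (hJ : J.Nodup) (hI' : I'.card = p - 1) (h : J + I' = replicate p l + r) :
    l ∈ J ∧ I' = replicate (p - 1) l ∧ J = l ::ₘ r := by
  have h1 := congrArg (count l) h
  simp only [count_add, count_replicate_self] at h1
  have h2 := Multiset.nodup_iff_count_le_one.1 hJ l
  have h3 := Multiset.count_le_card l I'
  have h4 : I' = replicate (p - 1) l := by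
    symm
    apply Multiset.eq_of_le_of_card_le
    · exact Multiset.le_count_iff_replicate_le.1 (by omega)
    · simp [hI']
  refine ⟨Multiset.count_pos.1 (by omega), h4, ?_⟩
  have h5 : p = (p - 1) + 1 := by omega
  rw [h4] at h
  rw [h5, replicate_add, add_comm J] at h
  simp only [Nat.add_sub_cancel, add_assoc] at h
  simpa using (add_left_cancel h)

theorem uniq1 (p n : ℕ) [NeZero n] (hp : 2 ≤ p) (hn : 3 ≤ n) (i : Fin n)
    (J I' J' : Multiset (Fin n)) (hJ : J.Nodup) (hJc : J.card = p - 1)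
    (hI' : I'.card = p - 1) (hJ' : J'.card = p - 1) (hi : i ∉ J) (hi1 : i + 1 ∉ J)
    (h : ww p (replicate (p - 1) i) + ww p J' ≡ ww p J + ww p I' [MOD p ^ n - 1]) :
    I' = replicate (p - 1) i ∧ J' = J := by
  rw [← ww_add, ← ww_add] at h
  rcases uniqU p n hp hn _ _ (by simp [hJ']; omega) (by simp [hJc, hI']; omega) h with
    h | ⟨l, r, l', r', e1, e2, e3⟩
  · have h1 := congrArg (count i) h
    simp only [count_add, count_replicate_self, Multiset.count_eq_zero_of_notMem hi] at h1
    have h4 : I' = replicate (p - 1) i := by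
      symm
      apply Multiset.eq_of_le_of_card_le
      · exact Multiset.le_count_iff_replicate_le.1 (by omega)
      · simp [hI']
    refine ⟨h4, ?_⟩
    rw [h4, add_comm J] at h
    exact add_left_cancel h
  · exfalso
    obtain ⟨a1, a2, a3⟩ := carry_nodup p n hp J I' r' l' hJ hI' e2
    have hl : l = i := by
      by_contra hne
      have h1 := congrArg (count l) e1
      simp only [count_add, count_replicate_self, count_replicate] at h1
      rw [if_neg (Ne.symm hne)] at h1
      have := Multiset.count_le_card l J'
      omega
    subst hl
    have : l + 1 ∈ (l' + 1) ::ₘ r' := by rw [← e3]; simp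
    rcases Multiset.mem_cons.1 this with h5 | h5
    · exact hi (by rw [add_right_cancel h5]; exact a1)
    · exact hi1 (by rw [a3]; exact Multiset.mem_cons_of_mem h5)

theorem uniq2 (p n : ℕ) [NeZero n] (hp : 2 ≤ p) (hn : 3 ≤ n)
    (I J I' J' : Multiset (Fin n)) (hI : I.Nodup) (hJ : J.Nodup)
    (hIc : I.card = p - 1) (hJc : J.card = p - 1)
    (hI' : I'.card = p - 1) (hJ' : J'.card = p - 1) (hd : ∀ x ∈ I, x ∉ J)
    (hx : ∀ l l', l ∈ I → l + 1 ∈ J → l' ∈ J → l' + 1 ∈ I → False)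
    (h : ww p I + ww p J' ≡ ww p J + ww p I' [MOD p ^ n - 1]) :
    I' = I ∧ J' = J := by
  rw [← ww_add, ← ww_add] at h
  rcases uniqU p n hp hn _ _ (by simp [hJ', hIc]; omega) (by simp [hJc, hI']; omega) h with
    h | ⟨l, r, l', r', e1, e2, e3⟩
  · have h4 : I' = I := by
      symm
      apply Multiset.eq_of_le_of_card_le
      · rw [Multiset.le_iff_subset hI]
        intro x hxI
        have : x ∈ J + I' := by rw [← h]; exact Multiset.mem_add.2 (Or.inl hxI)
        exact (Multiset.mem_add.1 this).resolve_left (hd x hxI)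
      · omega
    refine ⟨h4, ?_⟩
    rw [h4, add_comm J] at h
    exact add_left_cancel h
  · exfalso
    obtain ⟨a1, a2, a3⟩ := carry_nodup p n hp J I' r' l' hJ hI' e2
    obtain ⟨b1, b2, b3⟩ := carry_nodup p n hp I J' r l hI hJ' e1
    have hne : l ≠ l' := fun e => hd l b1 (e ▸ a1)
    have c1 : l + 1 ∈ (l' + 1) ::ₘ r' := by rw [← e3]; simp
    have c2 : l' + 1 ∈ (l + 1) ::ₘ r := by rw [e3]; simp
    have d1 := (Multiset.mem_cons.1 c1).resolve_left (fun e => hne (add_right_cancel e))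
    have d2 := (Multiset.mem_cons.1 c2).resolve_left (fun e => hne (add_right_cancel e).symm)
    exact hx l l' b1 (by rw [a3]; exact Multiset.mem_cons_of_mem d1) a1
      (by rw [b3]; exact Multiset.mem_cons_of_mem d2)
theorem greedy (n : ℕ) [NeZero n] (F : Finset (Fin n)) (hF : ∀ x ∈ F, -x ∈ F) (m : ℕ)
    (h : (m - 1) * F.card < n) :
    ∃ v : Fin m → Fin n, ∀ t s, t ≠ s → v t - v s ∉ F := by
  induction m with
  | zero => exact ⟨Fin.elim0, fun t => t.elim0⟩
  | succ m ih =>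
    obtain ⟨v, hv⟩ := ih (lt_of_le_of_lt (Nat.mul_le_mul_right _ (by omega)) h)
    have hex : ∃ y : Fin n, y ∉ (Finset.univ ×ˢ F).image (fun z : Fin m × Fin n => v z.1 + z.2) := by
      by_contra! hcon
      have h1 : (Finset.univ : Finset (Fin n)) ⊆
        (Finset.univ ×ˢ F).image (fun z : Fin m × Fin n => v z.1 + z.2) := fun y _ => hcon y
      have h2 := (Finset.card_le_card h1).trans Finset.card_image_le
      rw [Finset.card_product] at h2
      simp at h2 h
      omega
    obtain ⟨y, hy⟩ := hex
    have hy1 : ∀ t, y - v t ∉ F := by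
      intro t ht
      exact hy (Finset.mem_image.2 ⟨(t, y - v t), by simp [ht], by simp⟩)
    have hy2 : ∀ t, v t - y ∉ F := by
      intro t ht
      exact hy1 t (by simpa using hF _ ht)
    refine ⟨Fin.cons y v, ?_⟩
    intro t s
    refine Fin.cases ?_ (fun t => ?_) t <;> refine Fin.cases ?_ (fun s => ?_) s
    · simp
    · intro _; simpa using hy1 s
    · intro _; simpa using hy2 t
    · intro hne; simpa using hv t s (fun e => hne (by rw [e]))

theorem perm_of_map_eq {m n : ℕ} (v v' : Fin m → Fin n) (hv : Function.Injective v)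
    (h : (Finset.univ.val.map v') = Finset.univ.val.map v) :
    ∃ σ : Equiv.Perm (Fin m), v' = v ∘ σ := by
  have h1 : ∀ t, ∃ s, v s = v' t := by
    intro t
    have : v' t ∈ Finset.univ.val.map v := by rw [← h]; exact Multiset.mem_map_of_mem _ (by simp)
    obtain ⟨s, _, hs⟩ := Multiset.mem_map.1 this
    exact ⟨s, hs⟩
  choose f hf using h1
  have hinj : Function.Injective v' := by
    have h2 : (Finset.univ.val.map v').Nodup := by
      rw [h]; exact Multiset.Nodup.map hv Finset.univ.nodup
    intro a b hab
    exact Multiset.inj_on_of_nodup_map h2 a (by simp) b (by simp) hab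
  have hfi : Function.Injective f := by
    intro a b hab
    apply hinj
    rw [← hf, ← hf, hab]
  refine ⟨Equiv.ofBijective f (Finite.injective_iff_bijective.1 hfi), ?_⟩
  ext t
  simp [hf]

theorem expand (p n : ℕ) (hp : p.Prime) (E : Type*) [Field E] [Fintype E]
    (hE : Fintype.card E = p ^ n) (hn : 1 ≤ n)
    (A : Fin n → Fin n → E)
    (hA : ∀ x : Eˣ, (∑ z : Fin n × Fin n, A z.1 z.2 *
      ((x : E) ^ p ^ (z.1 : ℕ) * ((x⁻¹ : Eˣ) : E) ^ p ^ (z.2 : ℕ))) ^ (p - 1) = 1)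
    (u v : Fin (p - 1) → Fin n) (hv : Function.Injective v)
    (hne : ¬ (∑ t, p ^ (u t : ℕ)) ≡ ∑ t, p ^ (v t : ℕ) [MOD p ^ n - 1])
    (huniq : ∀ u' v' : Fin (p - 1) → Fin n,
      ((∑ t, p ^ (u t : ℕ)) + ∑ t, p ^ (v' t : ℕ)) ≡
        ((∑ t, p ^ (v t : ℕ)) + ∑ t, p ^ (u' t : ℕ)) [MOD p ^ n - 1] →
      (∀ t, A (u' t) (v' t) ≠ 0) → ∃ σ : Equiv.Perm (Fin (p - 1)), u' = u ∘ σ ∧ v' = v ∘ σ) :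
    ∏ t, A (u t) (v t) = 0 := by
  classical
  haveI : Fact p.Prime := ⟨hp⟩
  haveI : CharP E p := charP_of_card_eq_prime_pow hE
  set M := p ^ n - 1 with hM
  have hMpos : 1 ≤ M := by
    have : p ^ 1 ≤ p ^ n := Nat.pow_le_pow_right hp.pos hn
    have := hp.two_le
    simp at *
    omega
  set U := ∑ t, p ^ (u t : ℕ) with hU
  set V := ∑ t, p ^ (v t : ℕ) with hV
  -- divisibility criterion
  have key : ∀ a b : ℕ, M ∣ a + (M - 1) * b ↔ b ≡ a [MOD M] := by
    intro a b
    have e : a + (M - 1) * b + b = a + M * b := by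
      obtain ⟨k, hk⟩ : ∃ k, M = k + 1 := ⟨M - 1, by omega⟩
      rw [hk]; simp; ring
    constructor
    · intro h
      have h1 : (a + (M - 1) * b) + b ≡ 0 + b [MOD M] := Nat.ModEq.add_right _ (Nat.modEq_zero_iff_dvd.2 h)
      rw [e] at h1
      simpa [Nat.ModEq] using h1.symm
    · intro h
      apply Nat.modEq_zero_iff_dvd.1
      apply Nat.ModEq.add_right_cancel' b
      rw [e]
      simpa [Nat.ModEq] using h.symm
  have hinv : ∀ x : Eˣ, ((x⁻¹ : Eˣ) : E) = (x : E) ^ (M - 1) := by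
    intro x
    have h1 : x ^ M = 1 := by
      rw [hM, ← hE, ← Fintype.card_units]; exact pow_card_eq_one
    have : x⁻¹ = x ^ (M - 1) := by
      rw [inv_eq_iff_mul_eq_one, ← pow_succ', Nat.sub_add_cancel hMpos, h1]
    rw [this]; simp
  have hsum : ∀ a b : ℕ, ∑ x : Eˣ, ((x : E) ^ a * (((x⁻¹ : Eˣ) : E)) ^ b) =
      if b ≡ a [MOD M] then -1 else 0 := by
    intro a b
    simp_rw [hinv, ← pow_mul, ← pow_add]
    rw [FiniteField.sum_pow_units]
    simp only [hE, ← hM, key]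
  have h0 : ∑ x : Eˣ, ((x : E) ^ V * (((x⁻¹ : Eˣ) : E)) ^ U) = 0 := by
    rw [hsum, if_neg hne]
  have h1 : ∑ x : Eˣ, ((x : E) ^ V * (((x⁻¹ : Eˣ) : E)) ^ U) =
      ∑ f : Fin (p - 1) → Fin n × Fin n, (∏ t, A (f t).1 (f t).2) *
        if (U + ∑ t, p ^ ((f t).2 : ℕ)) ≡ V + ∑ t, p ^ ((f t).1 : ℕ) [MOD M] then -1 else 0 := by
    simp_rw [← hsum, Finset.mul_sum]
    rw [Finset.sum_comm]
    refine Finset.sum_congr rfl fun x _ => ?_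
    rw [← mul_one (_ * _), ← hA x, Fintype.sum_pow, Finset.mul_sum]
    refine Finset.sum_congr rfl fun f _ => ?_
    simp only [Finset.prod_mul_distrib, Finset.prod_pow_eq_pow_sum, pow_add]
    ring
  rw [h0] at h1
  let c : Equiv.Perm (Fin (p - 1)) → (Fin (p - 1) → Fin n × Fin n) := fun σ t => (u (σ t), v (σ t))
  have hc : Function.Injective c := by
    intro σ τ h
    ext t
    have := congrFun h t
    simp only [c, Prod.mk.injEq] at this
    rw [hv this.2]
  have h2 : ∑ f : Fin (p - 1) → Fin n × Fin n, (∏ t, A (f t).1 (f t).2) *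
        (if (U + ∑ t, p ^ ((f t).2 : ℕ)) ≡ V + ∑ t, p ^ ((f t).1 : ℕ) [MOD M] then (-1 : E) else 0)
      = ∑ σ : Equiv.Perm (Fin (p - 1)), - ∏ t, A (u t) (v t) := by
    symm
    apply Finset.sum_of_injOn c hc.injOn (by simp)
    · intro f _ hf
      by_contra hcon
      have h3 := left_ne_zero_of_mul hcon
      have h4 := right_ne_zero_of_mul hcon
      rw [Finset.prod_ne_zero_iff] at h3
      have h5 : (U + ∑ t, p ^ ((f t).2 : ℕ)) ≡ V + ∑ t, p ^ ((f t).1 : ℕ) [MOD M] := by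
        by_contra h6
        exact h4 (if_neg h6)
      obtain ⟨σ, s1, s2⟩ := huniq (fun t => (f t).1) (fun t => (f t).2) h5
        (fun t => h3 t (Finset.mem_univ t))
      apply hf
      refine ⟨σ, by simp, ?_⟩
      funext t
      exact Prod.ext (congrFun s1 t).symm (congrFun s2 t).symm
    · intro σ _
      simp only [c]
      rw [Equiv.sum_comp σ (fun t => p ^ (v t : ℕ)), Equiv.sum_comp σ (fun t => p ^ (u t : ℕ)),
        Equiv.prod_comp σ (fun t => A (u t) (v t)), ← hU, ← hV, if_pos (by rw [add_comm])]
      ring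
  rw [h2] at h1
  simp only [Finset.sum_const, Finset.card_univ, Fintype.card_perm, Fintype.card_fin,
    nsmul_eq_mul] at h1
  rcases mul_eq_zero.1 h1.symm with h3 | h3
  · rw [CharP.cast_eq_zero_iff E p, hp.dvd_factorial] at h3
    have := hp.two_le
    omega
  · simpa using h3

theorem ww_map (p : ℕ) {m n : ℕ} (v : Fin m → Fin n) :
    ww p (Finset.univ.val.map v) = ∑ t, p ^ (v t : ℕ) := by
  simp only [ww, Multiset.map_map]
  rfl

theorem step1 (p n : ℕ) [NeZero n] (hp : p.Prime) (E : Type*) [Field E] [Fintype E]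
    (hE : Fintype.card E = p ^ n) (hn : 3 ≤ n)
    (A : Fin n → Fin n → E)
    (hA : ∀ x : Eˣ, (∑ z : Fin n × Fin n, A z.1 z.2 *
      ((x : E) ^ p ^ (z.1 : ℕ) * ((x⁻¹ : Eˣ) : E) ^ p ^ (z.2 : ℕ))) ^ (p - 1) = 1)
    (i : Fin n) (v : Fin (p - 1) → Fin n) (hv : Function.Injective v)
    (hi : ∀ t, v t ≠ i) (hi1 : ∀ t, v t ≠ i + 1) :
    ∏ t, A i (v t) = 0 := by
  have hp2 := hp.two_le
  have hJ : (Finset.univ.val.map v).Nodup := Multiset.Nodup.map hv Finset.univ.nodup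
  have hrep : (Finset.univ.val.map (fun _ : Fin (p - 1) => i)) = replicate (p - 1) i := by
    simp
  have huq : ∀ u' v' : Fin (p - 1) → Fin n,
      ((∑ t : Fin (p - 1), p ^ (i : ℕ)) + ∑ t, p ^ (v' t : ℕ)) ≡
        ((∑ t, p ^ (v t : ℕ)) + ∑ t, p ^ (u' t : ℕ)) [MOD p ^ n - 1] →
      Finset.univ.val.map u' = replicate (p - 1) i ∧
        Finset.univ.val.map v' = Finset.univ.val.map v := by
    intro u' v' h
    apply uniq1 p n hp2 hn i _ _ _ hJ (by simp) (by simp) (by simp)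
    · simpa using hi
    · simpa using hi1
    · rw [← hrep]
      simpa only [ww_map] using h
  refine expand p n hp E hE (by omega) A hA (fun _ => i) v hv ?_ ?_
  · intro h
    have h1 := (huq (fun _ => i) (fun _ => i) (h.add_right _)).2
    have : v ⟨0, by omega⟩ ∈ Finset.univ.val.map v := Multiset.mem_map_of_mem _ (by simp)
    rw [← h1, hrep] at this
    exact hi _ (Multiset.eq_of_mem_replicate this)
  · intro u' v' h _
    obtain ⟨h1, h2⟩ := huq u' v' h
    obtain ⟨σ, hσ⟩ := perm_of_map_eq v v' hv h2
    refine ⟨σ, ?_, hσ⟩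
    funext t
    have : u' t ∈ Finset.univ.val.map u' := Multiset.mem_map_of_mem _ (by simp)
    rw [h1] at this
    exact Multiset.eq_of_mem_replicate this

theorem step2 (p n : ℕ) [NeZero n] (hp : p.Prime) (E : Type*) [Field E] [Fintype E]
    (hE : Fintype.card E = p ^ n) (hn : 3 ≤ n)
    (A : Fin n → Fin n → E)
    (hA : ∀ x : Eˣ, (∑ z : Fin n × Fin n, A z.1 z.2 *
      ((x : E) ^ p ^ (z.1 : ℕ) * ((x⁻¹ : Eˣ) : E) ^ p ^ (z.2 : ℕ))) ^ (p - 1) = 1)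
    (k : Fin n) (hk : k ≠ 0) (v : Fin (p - 1) → Fin n) (hv : Function.Injective v)
    (h1 : ∀ t s, t ≠ s → v t - v s ≠ -k)
    (h2 : ∀ t s, t ≠ s → v t - v s ≠ k + 1)
    (h3 : ∀ t s, t ≠ s → v t - v s ≠ k - 1)
    (h4 : ∀ t s, t ≠ s → A (v t + k) (v s) = 0) :
    ∏ t, A (v t + k) (v t) = 0 := by
  have hp2 := hp.two_le
  have hu : Function.Injective (fun t => v t + k) := fun a b h => hv (add_right_cancel h)
  have hJ : (Finset.univ.val.map v).Nodup := Multiset.Nodup.map hv Finset.univ.nodup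
  have hI : (Finset.univ.val.map (fun t => v t + k)).Nodup :=
    Multiset.Nodup.map hu Finset.univ.nodup
  have hd : ∀ t s, v t + k ≠ v s := by
    intro t s h
    by_cases hts : t = s
    · subst hts; exact hk (by simpa using h)
    · exact h1 t s hts (by rw [← h]; abel)
  have huq : ∀ u' v' : Fin (p - 1) → Fin n,
      ((∑ t, p ^ ((v t + k : Fin n) : ℕ)) + ∑ t, p ^ (v' t : ℕ)) ≡
        ((∑ t, p ^ (v t : ℕ)) + ∑ t, p ^ (u' t : ℕ)) [MOD p ^ n - 1] →
      Finset.univ.val.map u' = Finset.univ.val.map (fun t => v t + k) ∧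
        Finset.univ.val.map v' = Finset.univ.val.map v := by
    intro u' v' h
    apply uniq2 p n hp2 hn _ _ _ _ hI hJ (by simp) (by simp) (by simp) (by simp)
    · intro x hx hx'
      obtain ⟨t, _, rfl⟩ := Multiset.mem_map.1 hx
      obtain ⟨s, _, hs⟩ := Multiset.mem_map.1 hx'
      exact hd t s hs.symm
    · intro l l' a1 a2 a3 a4
      obtain ⟨t, _, rfl⟩ := Multiset.mem_map.1 a1
      obtain ⟨s, _, hs⟩ := Multiset.mem_map.1 a2
      obtain ⟨x, _, rfl⟩ := Multiset.mem_map.1 a3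
      obtain ⟨y, _, hy⟩ := Multiset.mem_map.1 a4
      have e1 : s = t := by
        by_contra hne
        exact h2 s t hne (by rw [hs]; abel)
      have e2 : x = y := by
        by_contra hne
        refine h3 x y hne ?_
        have : v x = v y + k - 1 := by rw [hy]; abel
        rw [this]; abel
      subst e1 e2
      have e3 : k + 1 = 0 := by
        have : v s = v s + (k + 1) := by rw [← add_assoc]; exact hs
        simpa using this
      have e4 : k = 1 := add_left_cancel hy
      rw [e4] at e3
      have := congrArg Fin.val e3
      rw [Fin.val_add, Fin.val_one', Nat.mod_eq_of_lt (by omega : 1 < n),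
        Nat.mod_eq_of_lt (by omega)] at this
      simp at this
    · simpa only [ww_map] using h
  refine expand p n hp E hE (by omega) A hA (fun t => v t + k) v hv ?_ ?_
  · intro h
    have h1 := (huq v v (h.add_right _)).1
    have : v ⟨0, by omega⟩ ∈ Finset.univ.val.map v := Multiset.mem_map_of_mem _ (by simp)
    rw [h1] at this
    obtain ⟨t, _, ht⟩ := Multiset.mem_map.1 this
    exact hd _ _ ht
  · intro u' v' h hne
    obtain ⟨h5, h6⟩ := huq u' v' h
    obtain ⟨σ, rfl⟩ := perm_of_map_eq v v' hv h6
    obtain ⟨τ, rfl⟩ := perm_of_map_eq _ u' hu h5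
    have : τ = σ := by
      ext t
      by_contra hc
      exact hne t (h4 _ _ (fun e => hc (by rw [e])))
    subst this
    exact ⟨τ, rfl, rfl⟩

theorem bound (p n : ℕ) (hp : 2 ≤ p) (hn : (p - 1) * (p ^ 2 - p + 4) ≤ 2 * n) :
    3 ≤ n ∧ (p - 2) * (2 * p + 3) < n := by
  obtain ⟨m, rfl⟩ : ∃ m, p = m + 2 := ⟨p - 2, by omega⟩
  have e : (m + 2) ^ 2 - (m + 2) = m ^ 2 + 3 * m + 2 := by
    have : (m + 2) ^ 2 = m ^ 2 + 3 * m + 2 + (m + 2) := by ring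
    omega
  rw [e] at hn
  have e1 : m + 2 - 1 = m + 1 := by omega
  have e2 : m + 2 - 2 = m := by omega
  rw [e1] at hn
  rw [e2]
  constructor
  · nlinarith [Nat.zero_le (m ^ 3), Nat.zero_le (m ^ 2)]
  · rcases Nat.lt_or_ge m 3 with h | h
    · interval_cases m <;> omega
    · nlinarith [Nat.mul_le_mul (Nat.mul_le_mul h h) (le_refl m)]

theorem stmt_10 (p n : ℕ) (hp : p.Prime) (hn : (p - 1) * (p ^ 2 - p + 4) ≤ 2 * n)
    (E : Type*) [Field E] [Fintype E] (hE : Fintype.card E = p ^ n)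
    (a : ℕ → E)
    (h : ∀ x : E, x ≠ 0 →
      ∑ j ∈ Finset.range n, ((∑ i ∈ Finset.range n, a i * x ^ p ^ i) / x) ^ p ^ j ≠ 0) :
    ∀ i : ℕ, 1 ≤ i → i ≤ n - 1 → a i = 0 := by
  classical
  have hp2 := hp.two_le
  obtain ⟨hn3, hbd⟩ := bound p n hp2 hn
  have : NeZero n := ⟨by omega⟩
  have : Fact p.Prime := ⟨hp⟩
  have : CharP E p := charP_of_card_eq_prime_pow hE
  have hfrob : ∀ (x : E) (j : Fin n) (i : Fin n), x ^ p ^ ((i + j : Fin n) : ℕ) =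
      (x ^ p ^ (i : ℕ)) ^ p ^ (j : ℕ) := by
    intro x j i
    rw [← pow_mul, ← pow_add, Fin.val_add]
    conv_rhs => rw [← Nat.mod_add_div ((i : ℕ) + j) n, pow_add, pow_mul, pow_mul p n, ← hE,
      FiniteField.pow_card_pow]
  let A : Fin n → Fin n → E := fun i j => a ((i - j : Fin n) : ℕ) ^ p ^ (j : ℕ)
  have hA0 : ∀ i j, A i j = 0 ↔ a ((i - j : Fin n) : ℕ) = 0 := by
    intro i j
    have : p ^ (j : ℕ) ≠ 0 := by positivity
    simp only [A]
    exact pow_eq_zero_iff this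
  have hA : ∀ x : Eˣ, (∑ z : Fin n × Fin n, A z.1 z.2 *
      ((x : E) ^ p ^ (z.1 : ℕ) * ((x⁻¹ : Eˣ) : E) ^ p ^ (z.2 : ℕ))) ^ (p - 1) = 1 := by
    intro x
    have hx := h x x.ne_zero
    have e1 : (∑ z : Fin n × Fin n, A z.1 z.2 *
      ((x : E) ^ p ^ (z.1 : ℕ) * ((x⁻¹ : Eˣ) : E) ^ p ^ (z.2 : ℕ))) =
      ∑ j ∈ Finset.range n, ((∑ i ∈ Finset.range n, a i * (x : E) ^ p ^ i) / x) ^ p ^ j := by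
      rw [Fintype.sum_prod_type_right, Finset.sum_range]
      refine Finset.sum_congr rfl fun j _ => ?_
      rw [Finset.sum_range, div_eq_mul_inv, Finset.sum_mul, sum_pow_char_pow]
      rw [← Equiv.sum_comp (Equiv.addRight j)]
      refine Finset.sum_congr rfl fun i _ => ?_
      simp only [A, Equiv.coe_addRight, add_sub_cancel_right, hfrob]
      rw [Units.val_inv_eq_inv_val]
      ring
    rw [e1]
    set y := (∑ i ∈ Finset.range n, a i * (x : E) ^ p ^ i) / x
    set T := ∑ j ∈ Finset.range n, y ^ p ^ j with hT
    have hTp : T ^ p = T := by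
      rw [hT, sum_pow_char]
      simp_rw [← pow_mul, ← pow_succ]
      have r1 := Finset.sum_range_succ (fun j => y ^ p ^ j) n
      have r2 := Finset.sum_range_succ' (fun j => y ^ p ^ j) n
      rw [r1] at r2
      have : y ^ p ^ n = y := by rw [← hE]; exact FiniteField.pow_card y
      simp only [this, pow_zero, pow_one] at r2
      exact (add_right_cancel r2).symm
    have : T ^ (p - 1) * T = 1 * T := by
      rw [← pow_succ, Nat.sub_add_cancel (by omega), hTp, one_mul]
    exact mul_right_cancel₀ hx this
  -- the support
  let S : Finset (Fin n) := Finset.univ.filter (fun k => k ≠ 0 ∧ a (k : ℕ) ≠ 0)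
  let T : Finset (Fin n) := Finset.univ.filter (fun j => j ≠ 0 ∧ j ≠ 1 ∧ a ((-j : Fin n) : ℕ) ≠ 0)
  have hTc : T.card ≤ p - 2 := by
    by_contra hcon
    obtain ⟨T', hT', hc⟩ := Finset.exists_subset_card_eq (s := T) (n := p - 1) (by omega)
    let v : Fin (p - 1) → Fin n := fun t => (T'.equivFinOfCardEq hc).symm t
    have hvT : ∀ t, v t ∈ T := fun t => hT' (Subtype.prop _)
    have hv : Function.Injective v := fun s t hst =>
      (T'.equivFinOfCardEq hc).symm.injective (Subtype.ext hst)
    have hvT' : ∀ t, v t ≠ 0 ∧ v t ≠ 1 ∧ a ((-(v t) : Fin n) : ℕ) ≠ 0 := fun t => by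
      simpa [T] using hvT t
    have := step1 p n hp E hE hn3 A hA 0 v hv (fun t => (hvT' t).1)
      (fun t => by simpa using (hvT' t).2.1)
    obtain ⟨t, _, ht⟩ := Finset.prod_eq_zero_iff.1 this
    rw [hA0, zero_sub] at ht
    exact (hvT' t).2.2 ht
  have hSc : S.card ≤ p - 1 := by
    have hsub : S ⊆ (insert 1 T).image (fun j => -j) := by
      intro k hk
      simp only [S, Finset.mem_filter, Finset.mem_univ, true_and] at hk
      refine Finset.mem_image.2 ⟨-k, ?_, neg_neg k⟩
      rw [Finset.mem_insert]
      by_cases h1 : -k = 1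
      · exact Or.inl h1
      · right
        simp only [T, Finset.mem_filter, Finset.mem_univ, true_and, neg_neg]
        exact ⟨by simpa using hk.1, h1, hk.2⟩
    have := (Finset.card_le_card hsub).trans Finset.card_image_le
    have := Finset.card_insert_le 1 T
    omega
  intro k0 hk1 hk2
  by_contra hak
  let k : Fin n := ⟨k0, by omega⟩
  have hk : k ≠ 0 := by
    intro e
    have := congrArg Fin.val e
    simp [k] at this
    omega
  have hkS : k ∈ S := by simp [S, hk]; exact hak
  let B : Finset (Fin n) := insert (-k) (insert (k + 1) (insert (k - 1) ((S.erase k).image (fun s => s - k))))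
  have hBc : B.card ≤ p + 1 := by
    have b1 := Finset.card_insert_le (-k) (insert (k + 1) (insert (k - 1) ((S.erase k).image (fun s => s - k))))
    have b2 := Finset.card_insert_le (k + 1) (insert (k - 1) ((S.erase k).image (fun s => s - k)))
    have b3 := Finset.card_insert_le (k - 1) ((S.erase k).image (fun s => s - k))
    have b4 := Finset.card_image_le (s := S.erase k) (f := fun s => s - k)
    have b5 := Finset.card_erase_of_mem hkS
    have b6 : 0 < S.card := Finset.card_pos.2 ⟨k, hkS⟩
    simp only [B]
    omega
  let F : Finset (Fin n) := insert 0 (B ∪ B.image (fun x => -x))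
  have hFc : F.card ≤ 2 * p + 3 := by
    have b1 := Finset.card_insert_le 0 (B ∪ B.image (fun x => -x))
    have b2 := Finset.card_union_le B (B.image (fun x => -x))
    have b3 := Finset.card_image_le (s := B) (f := fun x => -x)
    simp only [F]
    omega
  have hBF : ∀ x ∈ B, x ∈ F := fun x hx => by
    simp only [F, Finset.mem_insert, Finset.mem_union]; tauto
  have hF : ∀ x ∈ F, -x ∈ F := by
    intro x hx
    simp only [F, Finset.mem_insert, Finset.mem_union, Finset.mem_image] at hx ⊢
    rcases hx with rfl | hx | ⟨y, hy, rfl⟩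
    · left; simp
    · right; right; exact ⟨x, hx, rfl⟩
    · right; left; simpa using hy
  obtain ⟨v, hv⟩ := greedy n F hF (p - 1) (by
    refine lt_of_le_of_lt (Nat.mul_le_mul_left _ hFc) ?_
    have : p - 1 - 1 = p - 2 := by omega
    rw [this]; exact hbd)
  have hvB : ∀ t s, t ≠ s → v t - v s ∉ B := fun t s hts hB => hv t s hts (hBF _ hB)
  have hvi : Function.Injective v := by
    intro t s hts
    by_contra hne
    exact hv t s hne (by rw [hts, sub_self]; simp [F])
  have := step2 p n hp E hE hn3 A hA k hk v hvi
    (fun t s hts e => hvB t s hts (by rw [e]; simp [B]))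
    (fun t s hts e => hvB t s hts (by rw [e]; simp [B]))
    (fun t s hts e => hvB t s hts (by rw [e]; simp [B]))
    (by
      intro t s hts
      by_contra hne
      rw [hA0] at hne
      have e : v t - v s = (v t + k - v s) - k := by abel
      by_cases h0 : v t + k - v s = 0
      · refine hvB t s hts ?_
        rw [e, h0]; simp [B]
      · refine hvB t s hts ?_
        rw [e]
        simp only [B, Finset.mem_insert]
        right; right; right
        refine Finset.mem_image_of_mem (fun s => s - k) ?_
        rw [Finset.mem_erase]
        refine ⟨?_, by simp only [S, Finset.mem_filter, Finset.mem_univ, true_and]; exact ⟨h0, hne⟩⟩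
        intro e2
        apply hts
        apply hvi
        rw [← sub_eq_zero, e, e2, sub_self])
  obtain ⟨t, _, ht⟩ := Finset.prod_eq_zero_iff.1 this
  rw [hA0] at ht
  have e : v t + k - v t = k := by abel
  rw [e] at ht
  exact hak ht
end

section
/- Let p be a prime, n ≥ 1, and let L(X) = Σ_{i=0}^{n-1} a_i X^{p^i} with a_i ∈ F_{p^n} satisfy Tr_{p^n/p}(L(x)/x) ≠ 0 for every nonzero x ∈ F_{p^n}. Then for all integers 1 ≤ i_1 < i_2 < ⋯ < i_{p−1} and 0 ≤ t_{p−2} ≤ ⋯ ≤ t_2 ≤ t_1 with i_{p−1} + t_1 ≤ n−2, one has Σ_τ a_{i_{p−1}+τ(p−1)} · a_{i_{p−2}+τ(p−2)}^{p^{i_{p−1}−i_{p−2}}} · ⋯ · a_{i_1+τ(1)}^{p^{i_{p−1}−i_1}} = 0, where the sum is over all distinct tuples (τ(1), …, τ(p−1)) obtained by permuting the entries of (t_1, …, t_{p−2}, 0). -/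
lemma aux_digits (p : ℕ) : ∀ (n : ℕ) (c d : ℕ → ℕ), (∀ i, c i < p) → (∀ i, d i < p) →
    ∑ i ∈ Finset.range n, c i * p ^ i = ∑ i ∈ Finset.range n, d i * p ^ i →
    ∀ i < n, c i = d i := by
  intro n
  induction n with
  | zero => intro c d _ _ _ i hi; omega
  | succ n ih =>
    intro c d hc hd hs
    have key : ∀ c : ℕ → ℕ, ∑ i ∈ Finset.range (n+1), c i * p ^ i =
        c 0 + p * ∑ i ∈ Finset.range n, c (i+1) * p ^ i := by
      intro c
      rw [Finset.sum_range_succ', Finset.mul_sum, add_comm]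
      congr 1
      · simp
      · apply Finset.sum_congr rfl; intro i _; ring
    rw [key c, key d] at hs
    have h0 : c 0 = d 0 := by
      have := congrArg (· % p) hs
      simpa [Nat.add_mul_mod_self_left, Nat.mod_eq_of_lt (hc 0), Nat.mod_eq_of_lt (hd 0)] using this
    have hp : 0 < p := by have := hc 0; omega
    have h1 : ∑ i ∈ Finset.range n, c (i+1) * p ^ i = ∑ i ∈ Finset.range n, d (i+1) * p ^ i := by
      rw [h0] at hs
      exact Nat.eq_of_mul_eq_mul_left hp (by omega)
    intro i hi
    cases i with
    | zero => exact h0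
    | succ i =>
      exact ih (fun i => c (i+1)) (fun i => d (i+1)) (fun i => hc _) (fun i => hd _) h1 i (by omega)

lemma aux_sum (p n : ℕ) (A : Multiset ℕ) (hA : ∀ x ∈ A, x < n) :
    (A.map (fun x => p ^ x)).sum = ∑ i ∈ Finset.range n, A.count i * p ^ i := by
  rw [Finset.sum_multiset_map_count]
  simp only [smul_eq_mul]
  apply Finset.sum_subset
  · intro x hx; simp only [Multiset.mem_toFinset] at hx; simpa using hA x hx
  · intro x _ hx
    simp only [Multiset.mem_toFinset] at hx
    simp [Multiset.count_eq_zero_of_notMem hx]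

lemma aux_bound (p n : ℕ) (_hp : 2 ≤ p) (A : Multiset ℕ) (hA : ∀ x ∈ A, x < n)
    (hc : ∀ x, A.count x < p) : (A.map (fun x => p ^ x)).sum < p ^ n := by
  rw [aux_sum p n A hA]
  clear hA
  induction n with
  | zero => simp
  | succ n ih =>
    rw [Finset.sum_range_succ, pow_succ]
    have : A.count n + 1 ≤ p := hc n
    have := Nat.mul_le_mul_right (p^n) this
    nlinarith

lemma aux_unique (p n : ℕ) (hp : 2 ≤ p) (A B : Multiset ℕ) (hA : ∀ x ∈ A, x < n)
    (hB : ∀ x ∈ B, x < n) (hcA : ∀ x, A.count x < p) (hcB : ∀ x, B.count x < p)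
    (hA0 : 0 < A.card) (hB0 : 0 < B.card)
    (h : (A.map (fun x => p ^ x)).sum ≡ (B.map (fun x => p ^ x)).sum [MOD (p ^ n - 1)]) :
    A = B := by
  have pos : ∀ A : Multiset ℕ, 0 < A.card → 0 < (A.map (fun x => p ^ x)).sum := by
    intro A hA
    obtain ⟨x, hx⟩ := Multiset.card_pos_iff_exists_mem.1 hA
    have : p ^ x ≤ (A.map (fun x => p ^ x)).sum :=
      Multiset.single_le_sum (fun _ _ => Nat.zero_le _) _ (Multiset.mem_map_of_mem _ hx)
    have : 0 < p ^ x := by positivity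
    omega
  have a1 := pos A hA0
  have b1 := pos B hB0
  have a2 := aux_bound p n hp A hA hcA
  have b2 := aux_bound p n hp B hB hcB
  have heq : (A.map (fun x => p ^ x)).sum = (B.map (fun x => p ^ x)).sum := by
    generalize (A.map (fun x => p ^ x)).sum = s at *
    generalize (B.map (fun x => p ^ x)).sum = t at *
    generalize p ^ n = N at *
    obtain ⟨s, rfl⟩ : ∃ s', s = s' + 1 := ⟨s - 1, by omega⟩
    obtain ⟨t, rfl⟩ : ∃ s', t = s' + 1 := ⟨t - 1, by omega⟩
    have := Nat.ModEq.add_right_cancel' 1 h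
    have := Nat.ModEq.eq_of_lt_of_lt this (by omega) (by omega)
    omega
  rw [aux_sum p n A hA, aux_sum p n B hB] at heq
  have := aux_digits p n _ _ hcA hcB heq
  ext x
  by_cases hx : x < n
  · exact this x hx
  · rw [Multiset.count_eq_zero_of_notMem (fun h => hx (hA x h)),
      Multiset.count_eq_zero_of_notMem (fun h => hx (hB x h))]

/-- carry step -/
lemma aux_carry (p : ℕ) (hp : 2 ≤ p) (A : Multiset ℕ) (hA : A.card = 2 * (p - 1)) (e : ℕ)
    (he : p ≤ A.count e) : ∃ A' : Multiset ℕ, A'.card = p - 1 ∧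
      (A'.map (fun x => p ^ x)).sum = (A.map (fun x => p ^ x)).sum ∧ (∀ x, A'.count x < p) ∧
      e + 1 ∈ A' ∧ ∀ x ∈ A', x = e + 1 ∨ x ∈ A := by
  obtain ⟨R, rfl⟩ := Multiset.le_iff_exists_add.1 (Multiset.le_count_iff_replicate_le.1 he)
  simp only [Multiset.card_add, Multiset.card_replicate] at hA
  have hc : ((e+1) ::ₘ R).card = p - 1 := by simp; omega
  refine ⟨(e+1) ::ₘ R, hc, ?_, ?_, ?_, ?_⟩
  · simp [pow_succ, mul_comm]
  · intro x
    have := Multiset.count_le_card x ((e+1) ::ₘ R)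
    omega
  · simp
  · intro x hx
    simp at hx ⊢
    tauto

lemma aux_key_s11 (p n I : ℕ) (hp : 2 ≤ p) (hI : I + 2 ≤ n) (W V J T : Multiset ℕ)
    (hW : W.card = p - 1) (hV : V.card = p - 1) (hJ : J.card = p - 1) (hT : T.card = p - 1)
    (hWn : ∀ x ∈ W, x < n) (hVn : ∀ x ∈ V, x < n) (hJn : ∀ x ∈ J, x < I)
    (hTn : ∀ x ∈ T, I ≤ x ∧ x + 2 ≤ n) (hJd : J.Nodup)
    (h : ((W + J).map (fun x => p ^ x)).sum ≡ ((V + T).map (fun x => p ^ x)).sum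
      [MOD (p ^ n - 1)]) : W = T ∧ V = J := by
  have hA : (W + J).card = 2 * (p - 1) := by simp; omega
  have hB : (V + T).card = 2 * (p - 1) := by simp; omega
  have hAn : ∀ x ∈ W + J, x < n := by
    intro x hx
    rcases Multiset.mem_add.1 hx with hx | hx
    · exact hWn x hx
    · have := hJn x hx; omega
  have hBn : ∀ x ∈ V + T, x < n := by
    intro x hx
    rcases Multiset.mem_add.1 hx with hx | hx
    · exact hVn x hx
    · have := hTn x hx; omega
  have hBe : ∀ f, p ≤ (V + T).count f → f ∈ T := by
    intro f hf
    rw [Multiset.count_add] at hf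
    have := Multiset.count_le_card f V
    exact Multiset.count_pos.1 (by omega)
  by_cases cA : ∃ e, p ≤ (W + J).count e
  · exfalso
    obtain ⟨e, he⟩ := cA
    have he' := he
    rw [Multiset.count_add] at he'
    have h1 := Multiset.count_le_card e W
    have h2 := Multiset.nodup_iff_count_le_one.1 hJd e
    have heJ : e ∈ J := Multiset.count_pos.1 (by omega)
    have hWe : ∀ x ∈ W, e = x := Multiset.count_eq_card.1 (by omega)
    have heI := hJn e heJ
    obtain ⟨A', k1, k2, k3, k4, k5⟩ := aux_carry p hp _ hA e he
    have k6 : ∀ x ∈ A', x ≤ I := by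
      intro x hx
      rcases k5 x hx with rfl | hx
      · omega
      · rcases Multiset.mem_add.1 hx with hx | hx
        · have := hWe x hx; omega
        · have := hJn x hx; omega
    by_cases cB : ∃ f, p ≤ (V + T).count f
    · obtain ⟨f, hf⟩ := cB
      have hfT := hTn f (hBe f hf)
      obtain ⟨B', l1, l2, l3, l4, l5⟩ := aux_carry p hp _ hB f hf
      rw [← k2, ← l2] at h
      have := aux_unique p n hp A' B' (fun x hx => by have := k6 x hx; omega)
        (fun x hx => by
          rcases l5 x hx with rfl | hx
          · omega
          · exact hBn x hx) k3 l3 (by omega) (by omega) h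
      subst this
      have := k6 _ l4
      omega
    · push Not at cB
      rw [← k2] at h
      have := aux_unique p n hp A' _ (fun x hx => by have := k6 x hx; omega) hBn k3 cB
        (by omega) (by omega) h
      rw [← this] at hB
      omega
  · push Not at cA
    by_cases cB : ∃ f, p ≤ (V + T).count f
    · exfalso
      obtain ⟨f, hf⟩ := cB
      have hfT := hTn f (hBe f hf)
      obtain ⟨B', l1, l2, l3, l4, l5⟩ := aux_carry p hp _ hB f hf
      rw [← l2] at h
      have := aux_unique p n hp _ B' hAn
        (fun x hx => by
          rcases l5 x hx with rfl | hx
          · omega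
          · exact hBn x hx) cA l3 (by omega) (by omega) h
      rw [this] at hA
      omega
    · push Not at cB
      have hEq := aux_unique p n hp _ _ hAn hBn cA cB (by omega) (by omega) h
      have hle : J ≤ V := by
        rw [Multiset.le_iff_count]
        intro x
        by_cases hx : x ∈ J
        · have h3 : x ∉ T := fun h => by have := hTn x h; have := hJn x hx; omega
          have := congrArg (Multiset.count x) hEq
          rw [Multiset.count_add, Multiset.count_add, Multiset.count_eq_zero_of_notMem h3] at this
          omega
        · rw [Multiset.count_eq_zero_of_notMem hx]; omega
      have hVJ : J = V := Multiset.eq_of_le_of_card_le hle (by omega)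
      subst hVJ
      refine ⟨?_, rfl⟩
      rw [add_comm] at hEq
      exact add_left_cancel hEq

lemma aux_zpow_sum {G ι : Type*} [CommGroup G] (x : G) (s : Finset ι) (f : ι → ℤ) :
    x ^ (∑ k ∈ s, f k) = ∏ k ∈ s, x ^ f k := by
  classical
  induction s using Finset.induction_on with
  | empty => simp
  | insert i s hi ih => rw [Finset.sum_insert hi, Finset.prod_insert hi, zpow_add, ih]

lemma aux_perm {ι : Type*} [Fintype ι] (f g : ι → ℕ)
    (h : Finset.univ.val.map f = Finset.univ.val.map g) :
    ∃ π : Equiv.Perm ι, ∀ k, f k = g (π k) := by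
  classical
  have e : ∀ c, Nonempty ({a // f a = c} ≃ {b // g b = c}) := by
    intro c
    rw [← Fintype.card_eq]
    have := congrArg (Multiset.count c) h
    rw [Multiset.count_map, Multiset.count_map] at this
    rw [Fintype.card_subtype, Fintype.card_subtype]
    simp only [eq_comm (a := c)] at this
    exact this
  refine ⟨Equiv.ofFiberEquiv (fun c => (e c).some), fun k => ?_⟩
  exact (Equiv.ofFiberEquiv_map (fun c => (e c).some) k).symm

lemma aux_zsum {E : Type*} [Field E] [Fintype E] [DecidableEq E] (z : ℤ) :
    ∑ x : Eˣ, ((x ^ z : Eˣ) : E) = if ((Fintype.card E - 1 : ℕ) : ℤ) ∣ z then -1 else 0 := by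
  have hq : 0 < Fintype.card E - 1 := by
    have := Fintype.one_lt_card (α := E); omega
  obtain ⟨r, hr⟩ : ∃ r : ℕ, (r : ℤ) = z % ((Fintype.card E - 1 : ℕ) : ℤ) :=
    ⟨(z % ((Fintype.card E - 1 : ℕ) : ℤ)).toNat,
      Int.toNat_of_nonneg (Int.emod_nonneg _ (by omega))⟩
  have hz : z = r + ((Fintype.card E - 1 : ℕ) : ℤ) * (z / ((Fintype.card E - 1 : ℕ) : ℤ)) := by
    rw [hr]; exact (Int.emod_add_mul_ediv _ _).symm
  have h1 : ∀ x : Eˣ, ((x ^ z : Eˣ) : E) = (x : E) ^ r := by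
    intro x
    rw [hz, zpow_add, zpow_mul, zpow_natCast, zpow_natCast]
    have : x ^ (Fintype.card E - 1) = 1 := by
      have := pow_card_eq_one (x := x)
      rwa [Fintype.card_units] at this
    rw [this]; simp
  simp_rw [h1]
  rw [FiniteField.sum_pow_units]
  congr 1
  rw [eq_iff_iff, ← Int.natCast_dvd_natCast, hr]
  rw [Int.dvd_iff_emod_eq_zero, Int.emod_emod, ← Int.dvd_iff_emod_eq_zero]

lemma aux_pow_mod (p n a : ℕ) (hp : 0 < p) : p ^ a ≡ p ^ (a % n) [MOD (p ^ n - 1)] := by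
  conv_lhs => rw [← Nat.mod_add_div a n, pow_add, pow_mul]
  have h1 : p ^ n ≡ 1 [MOD (p ^ n - 1)] := by
    have : 1 ≤ p ^ n := Nat.one_le_pow _ _ hp
    exact ((Nat.modEq_iff_dvd' this).2 dvd_rfl).symm
  have := (h1.pow (a / n)).mul_left (p ^ (a % n))
  simpa using this

/-- The trace form raised to `p-1` is one. -/
lemma aux_trace {E : Type*} [Field E] [Fintype E] (p n : ℕ) (hp : p.Prime) [CharP E p]
    (hE : Fintype.card E = p ^ n) (y : E) (hy : ∑ j ∈ Finset.range n, y ^ p ^ j ≠ 0) :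
    (∑ j ∈ Finset.range n, y ^ p ^ j) ^ (p - 1) = 1 := by
  have : Fact p.Prime := ⟨hp⟩
  have h1 : (∑ j ∈ Finset.range n, y ^ p ^ j) ^ p = ∑ j ∈ Finset.range n, y ^ p ^ j := by
    have h2 : (∑ j ∈ Finset.range n, y ^ p ^ j) ^ p = ∑ j ∈ Finset.range n, y ^ p ^ (j+1) := by
      have := sum_pow_char_pow (R := E) p 1 (Finset.range n) (fun j => y ^ p ^ j)
      rw [pow_one] at this
      rw [this]
      apply Finset.sum_congr rfl
      intro j _
      rw [← pow_mul, pow_succ]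
    have h3 := Finset.sum_range_succ (fun j => y ^ p ^ j) n
    rw [Finset.sum_range_succ', ← h2, ← hE, FiniteField.pow_card] at h3
    simpa using h3
  have h4 : (∑ j ∈ Finset.range n, y ^ p ^ j) ^ (p - 1) * (∑ j ∈ Finset.range n, y ^ p ^ j)
      = 1 * ∑ j ∈ Finset.range n, y ^ p ^ j := by
    rw [← pow_succ, Nat.sub_add_cancel hp.one_le, h1, one_mul]
  exact mul_right_cancel₀ hy h4

lemma aux_expand {E : Type*} [Field E] (p n : ℕ) (hp : p.Prime) [CharP E p]
    (a : ℕ → E) (x : Eˣ) :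
    ∑ j ∈ Finset.range n, ((∑ i ∈ Finset.range n, a i * (x : E) ^ p ^ i) / x) ^ p ^ j =
    ∑ g ∈ Finset.range n ×ˢ Finset.range n,
      a g.1 ^ p ^ g.2 * ((x ^ ((p : ℤ) ^ (g.1 + g.2) - (p : ℤ) ^ g.2) : Eˣ) : E) := by
  have : Fact p.Prime := ⟨hp⟩
  rw [Finset.sum_product_right]
  apply Finset.sum_congr rfl
  intro j _
  rw [Finset.sum_div, sum_pow_char_pow]
  apply Finset.sum_congr rfl
  intro i _
  have h1 : ((p : ℤ) ^ (i + j)) = ((p ^ (i + j) : ℕ) : ℤ) := by push_cast; rfl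
  have h2 : ((p : ℤ) ^ j) = ((p ^ j : ℕ) : ℤ) := by push_cast; rfl
  simp only [h1, h2]
  rw [zpow_sub, zpow_natCast, zpow_natCast, div_pow, mul_pow, ← pow_mul, ← pow_add]
  push_cast
  rw [← div_eq_mul_inv, mul_div_assoc]

/-- Vanishing of the coefficients of `F^(p-1)`. -/
lemma aux_coeff_s11 {E : Type*} [Field E] [Fintype E] (p n : ℕ) (hp : p.Prime)
    [CharP E p] (hE : Fintype.card E = p ^ n) (a : ℕ → E)
    (h : ∀ x : E, x ≠ 0 →
      ∑ j ∈ Finset.range n, ((∑ i ∈ Finset.range n, a i * x ^ p ^ i) / x) ^ p ^ j ≠ 0)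
    (s : ℤ) (hs : ¬ ((p ^ n - 1 : ℕ) : ℤ) ∣ s) :
    ∑ g ∈ (Fintype.piFinset (fun _ : Fin (p - 1) => Finset.range n ×ˢ Finset.range n)).filter
      (fun g => ((p ^ n - 1 : ℕ) : ℤ) ∣
        (∑ k, ((p : ℤ) ^ ((g k).1 + (g k).2) - (p : ℤ) ^ (g k).2)) - s),
      ∏ k, a (g k).1 ^ p ^ (g k).2 = 0 := by
  classical
  have h1 : ∀ x : Eˣ, ∑ g ∈ Fintype.piFinset
      (fun _ : Fin (p - 1) => Finset.range n ×ˢ Finset.range n),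
      (∏ k, a (g k).1 ^ p ^ (g k).2) *
        ((x ^ ((∑ k, ((p : ℤ) ^ ((g k).1 + (g k).2) - (p : ℤ) ^ (g k).2)) - s) : Eˣ) : E)
        = ((x ^ (-s) : Eˣ) : E) := by
    intro x
    have h2 := aux_trace p n hp hE _ (h x x.ne_zero)
    rw [aux_expand p n hp a x] at h2
    have h3 := Finset.prod_univ_sum (fun _ : Fin (p - 1) => Finset.range n ×ˢ Finset.range n)
      (fun _ g => a g.1 ^ p ^ g.2 * ((x ^ ((p : ℤ) ^ (g.1 + g.2) - (p : ℤ) ^ g.2) : Eˣ) : E))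
    rw [Finset.prod_const, Finset.card_univ, Fintype.card_fin, h2] at h3
    rw [← one_mul ((x ^ (-s) : Eˣ) : E), h3, Finset.sum_mul]
    apply Finset.sum_congr rfl
    intro g _
    rw [Finset.prod_mul_distrib, mul_assoc, sub_eq_add_neg, zpow_add, Units.val_mul]
    congr 2
    rw [← Units.coe_prod]
    congr 1
    exact aux_zpow_sum x _ _
  have h4 := Finset.sum_congr (rfl : (Finset.univ : Finset Eˣ) = Finset.univ) (fun x _ => h1 x)
  rw [aux_zsum, hE, if_neg (by rwa [dvd_neg]), Finset.sum_comm] at h4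
  simp_rw [← Finset.mul_sum, aux_zsum, hE] at h4
  rw [Finset.sum_filter, ← neg_eq_zero, ← Finset.sum_neg_distrib]
  refine Eq.trans ?_ h4
  apply Finset.sum_congr rfl
  intro g _
  split_ifs <;> simp

/-- if `L(X) = Σ_{i<n} a_i X^{p^i}` over `F_{p^n}` satisfies
`Tr_{p^n/p}(L(x)/x) ≠ 0` for all nonzero `x`, then for all
`1 ≤ i_1 < ⋯ < i_{p−1}` (given by the strictly monotone `idx : Fin (p-1) → ℕ`) and
`t_1 ≥ t_2 ≥ ⋯ ≥ t_{p−2} ≥ 0` (given by the antitone `tvals : Fin (p-1) → ℕ` whose last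
entry is `0`) with `i_{p−1} + t_1 ≤ n − 2`, one has
`Σ_σ ∏_k a_{i_k + σ(k)}^{p^{i_{p−1} − i_k}} = 0`, where `σ` runs over all distinct
tuples obtained by permuting the entries of `(t_1, …, t_{p−2}, 0)`. -/
theorem stmt_11 (p n : ℕ) (hp : p.Prime) (hn : 1 ≤ n)
    (E : Type*) [Field E] [Fintype E] (hE : Fintype.card E = p ^ n)
    (a : ℕ → E)
    (h : ∀ x : E, x ≠ 0 →
      ∑ j ∈ Finset.range n, ((∑ i ∈ Finset.range n, a i * x ^ p ^ i) / x) ^ p ^ j ≠ 0)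
    (idx tvals : Fin (p - 1) → ℕ)
    (hidx : StrictMono idx)
    (hidx1 : 1 ≤ idx ⟨0, by have := hp.two_le; omega⟩)
    (htv : Antitone tvals)
    (htv0 : tvals ⟨p - 2, by have := hp.two_le; omega⟩ = 0)
    (hbound : idx ⟨p - 2, by have := hp.two_le; omega⟩
        + tvals ⟨0, by have := hp.two_le; omega⟩ ≤ n - 2) :
    ∑ σ ∈ Finset.image (fun π : Equiv.Perm (Fin (p - 1)) => tvals ∘ π) Finset.univ,
      ∏ k : Fin (p - 1),
        a (idx k + σ k) ^ p ^ (idx ⟨p - 2, by have := hp.two_le; omega⟩ - idx k) = 0 := by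
  classical
  have hp2 := hp.two_le
  have : Fact p.Prime := ⟨hp⟩
  have : CharP E p := charP_of_card_eq_prime_pow hE
  have hpos : 0 < p - 1 := by omega
  obtain ⟨I, hI⟩ : ∃ I, I = idx ⟨p - 2, by omega⟩ := ⟨_, rfl⟩
  rw [← hI] at hbound ⊢
  have hi1 : ∀ k, 1 ≤ idx k := fun k =>
    hidx1.trans (hidx.monotone (Fin.mk_le_of_le_val (Nat.zero_le _)))
  have hiI : ∀ k, idx k ≤ I := fun k => by
    rw [hI]
    apply hidx.monotone
    rw [Fin.le_def]
    have := k.2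
    simp only
    omega
  have ht : ∀ k, I + tvals k ≤ n - 2 := fun k => by
    have : tvals k ≤ tvals ⟨0, by omega⟩ := htv (Fin.mk_le_of_le_val (Nat.zero_le _))
    omega
  have hI1 : 1 ≤ I := (hi1 ⟨0, hpos⟩).trans (hiI _)
  have hIn : I + 2 ≤ n := by
    have := ht ⟨0, hpos⟩
    omega
  -- the exponent
  have hs : ¬ ((p ^ n - 1 : ℕ) : ℤ) ∣
      ∑ k : Fin (p - 1), ((p : ℤ) ^ (I + tvals k) - (p : ℤ) ^ (I - idx k)) := by
    have hlow : 0 < ∑ k : Fin (p - 1), ((p : ℤ) ^ (I + tvals k) - (p : ℤ) ^ (I - idx k)) := by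
      apply Finset.sum_pos
      · intro k _
        have : (p : ℤ) ^ (I - idx k) < (p : ℤ) ^ (I + tvals k) := by
          apply pow_lt_pow_right₀
          · exact_mod_cast hp.one_lt
          · have := hi1 k; omega
        linarith
      · exact ⟨⟨0, hpos⟩, Finset.mem_univ _⟩
    have hup : ∑ k : Fin (p - 1), ((p : ℤ) ^ (I + tvals k) - (p : ℤ) ^ (I - idx k)) ≤
        ∑ k : Fin (p - 1), (p : ℤ) ^ (n - 2) := by
      apply Finset.sum_le_sum
      intro k _
      have h1 : (p : ℤ) ^ (I + tvals k) ≤ (p : ℤ) ^ (n - 2) :=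
        pow_le_pow_right₀ (by exact_mod_cast hp.one_le) (ht k)
      have h2 : (0 : ℤ) ≤ (p : ℤ) ^ (I - idx k) := by positivity
      linarith
    have hup2 : ∑ k : Fin (p - 1), (p : ℤ) ^ (n - 2) < ((p ^ n - 1 : ℕ) : ℤ) := by
      rw [Finset.sum_const, Finset.card_univ, Fintype.card_fin, nsmul_eq_mul]
      obtain ⟨m, rfl⟩ : ∃ m, n = m + 2 := ⟨n - 2, by omega⟩
      have h1 : 1 ≤ p ^ (m + 2) := Nat.one_le_pow _ _ hp.pos
      rw [Nat.cast_sub h1, Nat.cast_sub hp.one_le]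
      push_cast
      have h2 : (1 : ℤ) ≤ (p : ℤ) ^ m := by exact_mod_cast Nat.one_le_pow _ _ hp.pos
      have h3 : (2 : ℤ) ≤ p := by exact_mod_cast hp2
      rw [pow_add]
      have h4 : (0 : ℤ) ≤ (p : ℤ) ^ 2 - p - 2 := by nlinarith
      have h5 : (0 : ℤ) ≤ (p : ℤ) ^ m * ((p : ℤ) ^ 2 - p - 2) := mul_nonneg (by linarith) h4
      linarith
    intro hdvd
    have := Int.le_of_dvd hlow hdvd
    linarith
  have hco := aux_coeff_s11 p n hp hE a h _ hs
  have hsum : ∑ π ∈ (Finset.univ : Finset (Equiv.Perm (Fin (p - 1)))) ×ˢ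
      Finset.image (fun π : Equiv.Perm (Fin (p - 1)) => tvals ∘ π) Finset.univ,
      (∏ k : Fin (p - 1), a (idx k + π.2 k) ^ p ^ (I - idx k)) = 0 := by
    rw [← hco]
    refine Finset.sum_bij
      (fun π _ => fun k => (idx (π.1 k) + π.2 (π.1 k), I - idx (π.1 k))) ?_ ?_ ?_ ?_
    · rintro ⟨π, σ⟩ hπ
      simp only [Finset.mem_product, Finset.mem_univ, true_and, Finset.mem_image] at hπ
      obtain ⟨ρ, rfl⟩ := hπ
      rw [Finset.mem_filter]
      constructor
      · rw [Fintype.mem_piFinset]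
        intro k
        have h1 := hiI (π k)
        have h2 := ht (ρ (π k))
        simp only [Finset.mem_product, Finset.mem_range, Function.comp]
        omega
      · have e1 : ∀ k, idx (π k) + (tvals ∘ ρ) (π k) + (I - idx (π k)) = I + tvals (ρ (π k)) := by
          intro k
          have h1 := hiI (π k)
          simp only [Function.comp]
          omega
        simp only [e1, Finset.sum_sub_distrib]
        have e2 := Equiv.sum_comp (π.trans ρ) (fun k => (p : ℤ) ^ (I + tvals k))
        have e3 := Equiv.sum_comp π (fun k => (p : ℤ) ^ (I - idx k))
        simp only [Equiv.trans_apply] at e2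
        rw [e2, e3, sub_self]
        exact dvd_zero _
    · rintro ⟨π, σ⟩ hπ ⟨π', σ'⟩ hπ' heq
      have h1 : ∀ k, idx (π k) = idx (π' k) := by
        intro k
        have := congrArg Prod.snd (congrFun heq k)
        simp only at this
        have h1 := hiI (π k)
        have h2 := hiI (π' k)
        omega
      have h2 : π = π' := Equiv.ext fun k => hidx.injective (h1 k)
      subst h2
      have h3 : σ = σ' := by
        funext k
        have := congrArg Prod.fst (congrFun heq (π.symm k))
        simpa using this
      rw [h3]
    · intro g hg
      rw [Finset.mem_filter, Fintype.mem_piFinset] at hg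
      obtain ⟨hg1, hg2⟩ := hg
      have hgn : ∀ k, (g k).1 < n ∧ (g k).2 < n := by
        intro k
        simpa using hg1 k
      have key := aux_key_s11 p n I hp2 hIn
        (Finset.univ.val.map (fun k => ((g k).1 + (g k).2) % n))
        (Finset.univ.val.map (fun k => (g k).2))
        (Finset.univ.val.map (fun k => I - idx k))
        (Finset.univ.val.map (fun k => I + tvals k))
        (by simp) (by simp) (by simp) (by simp)
        (by
          intro x hx
          obtain ⟨k, _, rfl⟩ := Multiset.mem_map.1 hx
          exact Nat.mod_lt _ (by omega))
        (by
          intro x hx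
          obtain ⟨k, _, rfl⟩ := Multiset.mem_map.1 hx
          exact (hgn k).2)
        (by
          intro x hx
          obtain ⟨k, _, rfl⟩ := Multiset.mem_map.1 hx
          have := hi1 k
          omega)
        (by
          intro x hx
          obtain ⟨k, _, rfl⟩ := Multiset.mem_map.1 hx
          have := ht k
          omega)
        (by
          refine Multiset.Nodup.map ?_ Finset.univ.nodup
          intro k l hkl
          have h1 := hiI k
          have h2 := hiI l
          simp only at hkl
          exact hidx.injective (by omega))
        (by
          simp only [Multiset.map_add, Multiset.sum_add, Multiset.map_map, Function.comp_def]
          change (∑ k, p ^ (((g k).1 + (g k).2) % n)) + (∑ k, p ^ (I - idx k)) ≡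
            (∑ k, p ^ (g k).2) + (∑ k, p ^ (I + tvals k)) [MOD (p ^ n - 1)]
          have m1 : (∑ k, p ^ ((g k).1 + (g k).2)) ≡ ∑ k, p ^ (((g k).1 + (g k).2) % n)
              [MOD (p ^ n - 1)] := by
            rw [← ZMod.natCast_eq_natCast_iff]
            push_cast
            apply Finset.sum_congr rfl
            intro k _
            have := (ZMod.natCast_eq_natCast_iff _ _ _).2
              (aux_pow_mod p n ((g k).1 + (g k).2) hp.pos)
            exact_mod_cast this
          refine (m1.symm.add_right _).trans ?_
          apply Nat.ModEq.symm
          rw [Nat.modEq_iff_dvd]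
          convert hg2 using 1
          push_cast
          simp only [Finset.sum_sub_distrib]
          ring)
      obtain ⟨kW, kV⟩ := key
      obtain ⟨ρ, hρ⟩ := aux_perm _ _ kW
      obtain ⟨π, hπ⟩ := aux_perm _ _ kV
      refine ⟨(π, tvals ∘ (π.symm.trans ρ)), ?_, ?_⟩
      · simp only [Finset.mem_product, Finset.mem_univ, true_and, Finset.mem_image]
        exact ⟨_, rfl⟩
      · funext k
        have h1 := hρ k
        have h2 := hπ k
        have h3 := hgn k
        have h4 := hi1 (π k)
        have h5 := hiI (π k)
        have h6 := ht (ρ k)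
        ext
        · simp only [Function.comp, Equiv.trans_apply, Equiv.symm_apply_apply]
          by_cases hlt : (g k).1 + (g k).2 < n
          · rw [Nat.mod_eq_of_lt hlt] at h1
            omega
          · rw [Nat.mod_eq_sub_mod (by omega), Nat.mod_eq_of_lt (by omega)] at h1
            omega
        · exact h2.symm
    · rintro ⟨π, σ⟩ hπ
      exact (Equiv.prod_comp π (fun k => a (idx k + σ k) ^ p ^ (I - idx k))).symm
  rw [Finset.sum_product] at hsum
  dsimp only at hsum
  rw [Finset.sum_const, Finset.card_univ, Fintype.card_perm,
    Fintype.card_fin, nsmul_eq_mul] at hsum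
  rcases mul_eq_zero.1 hsum with h0 | h0
  · exfalso
    rw [CharP.cast_eq_zero_iff E p, hp.dvd_factorial] at h0
    omega
  · exact h0
end

section
/- Let p be a prime, q = p^m a power of p, n ≥ 1, and let L(X) = Σ_{i=0}^{n-1} a_i X^{q^i} with a_i ∈ F_{q^n} and (a_1, …, a_{n−1}) ≠ (0, …, 0). For each integer 1 ≤ j ≤ q^n−2 with gcd(j, q^n−1) = 1, let ℓ(j) = max{ Lead(Res(j(q^i−1))) : 1 ≤ i ≤ n−1 and a_i ≠ 0 }, and let ℓ = min of ℓ(j) over all such j. Suppose Tr_{q^n/q}(a_0) ≠ 0. If q^n + 1 − ((q−1)(ℓ−1)/2)·⌊2q^{n/2}⌋ > 1, then there exists a nonzero x ∈ F_{q^n} with Tr_{q^n/q}(L(x)/x) = 0 (i.e., it is impossible that Tr_{q^n/q}(L(x)/x) ≠ 0 for all nonzero x). -/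
/-- `leadFn p N j` is the smallest nonnegative integer in the `p`-cyclotomic coset of
`j` modulo `N`, i.e. the smallest `k` with `k ≡ j·p^u (mod N)` for some `u ≥ 0`. -/
noncomputable def leadFn (p N j : ℕ) : ℕ := sInf {k : ℕ | ∃ u : ℕ, k % N = j * p ^ u % N}

theorem core_A {E : Type*} [Field E] [Fintype E] {ι : Type*} [Fintype ι] [DecidableEq ι] (N : ℕ)
    (w : ι → E) (ex : ι → ℕ)
    (hT : ∀ x : E, x ≠ 0 → (∑ i, w i * x ^ ex i) ^ N = 1)
    (k0 : ι → ℕ) (hk0 : ∑ i, k0 i = N)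
    (hnd : ¬ (Fintype.card E - 1) ∣ ∑ i, k0 i * ex i)
    (hco : (Nat.multinomial Finset.univ k0 : E) * ∏ i, w i ^ k0 i ≠ 0)
    (huniq : ∀ k : ι → ℕ, ∑ i, k i = N → (∀ i, k i ≠ 0 → w i ≠ 0) →
      (∑ i, k i * ex i) ≡ (∑ i, k0 i * ex i) [MOD (Fintype.card E - 1)] → k = k0) : False := by
  classical
  set M := Fintype.card E - 1 with hM
  have hMpos : 1 ≤ M := by
    have := Fintype.one_lt_card (α := E)
    omega
  set K0 := ∑ i, k0 i * ex i with hK0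
  have hdvd : ∀ K : ℕ, M ∣ K + (M - 1) * K0 → K ≡ K0 [MOD M] := by
    intro K h
    have h1 : K + (M - 1) * K0 ≡ K0 + (M - 1) * K0 [MOD M] := by
      have h2 : K0 + (M - 1) * K0 = M * K0 := by
        obtain ⟨c, hc⟩ : ∃ c, M = c + 1 := ⟨M - 1, by omega⟩
        rw [hc]; simp; ring
      rw [h2]
      exact ((Nat.modEq_zero_iff_dvd).2 h).trans ((Nat.modEq_zero_iff_dvd).2 ⟨_, rfl⟩).symm
    exact Nat.ModEq.add_right_cancel' _ h1
  have e1 : ∑ x : Eˣ, (∑ i, w i * (x : E) ^ ex i) ^ N * (x : E) ^ ((M - 1) * K0) = 0 := by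
    have : ∀ x : Eˣ, (∑ i, w i * (x : E) ^ ex i) ^ N * (x : E) ^ ((M - 1) * K0)
        = (x ^ ((M - 1) * K0) : E) := by
      intro x; rw [hT _ x.ne_zero, one_mul]
    rw [Finset.sum_congr rfl (fun x _ => this x), FiniteField.sum_pow_units, if_neg]
    intro h
    have := hdvd 0 (by simpa using h)
    exact hnd ((Nat.modEq_zero_iff_dvd).1 this.symm)
  have e2 : ∀ x : Eˣ, (∑ i, w i * (x : E) ^ ex i) ^ N * (x : E) ^ ((M - 1) * K0)
      = ∑ k ∈ Finset.piAntidiag Finset.univ N, (Nat.multinomial Finset.univ k : E) * (∏ i, w i ^ k i) *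
          (x ^ ((∑ i, k i * ex i) + (M - 1) * K0) : E) := by
    intro x
    rw [Finset.sum_pow_eq_sum_piAntidiag, Finset.sum_mul]
    refine Finset.sum_congr rfl fun k _ => ?_
    simp only [mul_pow, Finset.prod_mul_distrib]
    rw [pow_add, ← Finset.prod_pow_eq_pow_sum]
    have : ∀ i, ((x : E) ^ ex i) ^ k i = (x : E) ^ (k i * ex i) := by
      intro i; rw [← pow_mul, mul_comm]
    simp only [this]
    ring
  rw [Finset.sum_congr rfl (fun x _ => e2 x), Finset.sum_comm] at e1
  simp_rw [← Finset.mul_sum, FiniteField.sum_pow_units] at e1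
  rw [Finset.sum_eq_single k0] at e1
  · rw [if_pos] at e1
    · apply hco
      simpa using e1
    · have h2 : K0 + (M - 1) * K0 = M * K0 := by
        obtain ⟨c, hc⟩ : ∃ c, M = c + 1 := ⟨M - 1, by omega⟩
        rw [hc]; simp; ring
      rw [← hK0, h2]; exact ⟨_, rfl⟩
  · intro k hk hne
    split_ifs with h
    · by_cases hw : ∀ i, k i ≠ 0 → w i ≠ 0
      · exact absurd (huniq k (by simpa using hk) hw (hdvd _ h)) hne
      · push Not at hw
        obtain ⟨i, hi, hwi⟩ := hw
        have : ∏ i, w i ^ k i = 0 := Finset.prod_eq_zero (Finset.mem_univ i) (by rw [hwi, zero_pow hi])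
        rw [this]; simp
    · simp
  · intro h
    exact absurd (by simpa using hk0) h

theorem digits_unique (q n : ℕ) [NeZero n] (P R : ZMod n → ℕ) (hP : ∀ v, P v < q) (hR : ∀ v, R v < q)
    (hP0 : ∃ v, P v ≠ 0) (hR0 : ∃ v, R v ≠ 0)
    (h : ∑ v, P v * q ^ v.val ≡ ∑ v, R v * q ^ v.val [MOD q ^ n - 1]) : P = R := by
  have hq : 0 < q := lt_of_le_of_lt (Nat.zero_le _) (hP 0)
  obtain ⟨n', rfl⟩ : ∃ n', n = n' + 1 := ⟨n - 1, by have := NeZero.ne n; omega⟩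
  have key : ∀ P : ZMod (n'+1) → ℕ, ∀ hP : ∀ v, P v < q,
      ((finFunctionFinEquiv (fun i : Fin (n'+1) => (⟨P i, hP i⟩ : Fin q)) : Fin (q ^ (n'+1))) : ℕ)
      = ∑ v, P v * q ^ v.val := by
    intro P hP
    rw [finFunctionFinEquiv_apply]
    rfl
  have lt : ∀ P : ZMod (n'+1) → ℕ, (∀ v, P v < q) → ∑ v, P v * q ^ v.val < q ^ (n'+1) := by
    intro P hP
    rw [← key P hP]; exact Fin.is_lt _
  have pos : ∀ P : ZMod (n'+1) → ℕ, (∃ v, P v ≠ 0) → 0 < ∑ v, P v * q ^ v.val := by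
    rintro P ⟨v, hv⟩
    refine Finset.sum_pos' (fun _ _ => Nat.zero_le _) ⟨v, Finset.mem_univ _, ?_⟩
    positivity
  have heq : ∑ v, P v * q ^ v.val = ∑ v, R v * q ^ v.val := by
    have a1 := lt P hP
    have a2 := lt R hR
    have a3 := pos P hP0
    have a4 := pos R hR0
    generalize ∑ v, P v * q ^ v.val = A at *
    generalize ∑ v, R v * q ^ v.val = B at *
    have h' : (A - 1) ≡ (B - 1) [MOD q ^ (n'+1) - 1] := by
      apply Nat.ModEq.add_right_cancel' 1
      rwa [Nat.sub_add_cancel a3, Nat.sub_add_cancel a4]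
    have := Nat.ModEq.eq_of_lt_of_lt h' (by omega) (by omega)
    omega
  rw [← key P hP, ← key R hR] at heq
  have := finFunctionFinEquiv.injective (Fin.ext heq)
  funext v
  have h3 := congrFun this v
  simpa using h3

theorem pow_val_succ (q n : ℕ) [NeZero n] (hq : 1 ≤ q) (e : ZMod n) (hn : 2 ≤ n) :
    q * q ^ e.val ≡ q ^ (e + 1).val [MOD q ^ n - 1] := by
  have : Fact (1 < n) := ⟨hn⟩
  have h1 := ZMod.val_add e 1
  rw [ZMod.val_one] at h1
  have hlt := ZMod.val_lt e
  rcases Nat.lt_or_ge (e.val + 1) n with h | h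
  · rw [Nat.mod_eq_of_lt h] at h1
    rw [h1, pow_succ, mul_comm]
  · have h2 : e.val + 1 = n := by omega
    rw [h2, Nat.mod_self] at h1
    rw [h1, ← pow_succ', h2, pow_zero]
    have : 1 ≤ q ^ n := Nat.one_le_pow _ _ hq
    have h3 : (q ^ n - 1) + 1 = q ^ n := by omega
    conv_lhs => rw [← h3]
    simp [Nat.ModEq]

theorem shift_lemma (q n : ℕ) [NeZero n] (hq : 2 ≤ q) (hn : 2 ≤ n) (P : ZMod n → ℕ)
    (hs : ∑ v, P v = 2 * (q - 1)) (e : ZMod n) (he : q ≤ P e) :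
    ∃ P1 : ZMod n → ℕ, (∀ v, P v + (if v = e + 1 then 1 else 0) = P1 v + (if v = e then q else 0)) ∧
      ∑ v, P1 v = q - 1 ∧ ∑ v, P v * q ^ v.val ≡ ∑ v, P1 v * q ^ v.val [MOD q ^ n - 1] := by
  refine ⟨fun v => P v + (if v = e + 1 then 1 else 0) - (if v = e then q else 0), ?_, ?_, ?_⟩
  · intro v
    by_cases h : v = e
    · subst h; simp; omega
    · simp [h]
  all_goals
    set P1 : ZMod n → ℕ := fun v => P v + (if v = e + 1 then 1 else 0) - (if v = e then q else 0) with hP1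
    have h1 : ∀ v, P v + (if v = e + 1 then 1 else 0) = P1 v + (if v = e then q else 0) := by
      intro v
      by_cases h : v = e
      · subst h; simp [hP1]; omega
      · simp [h, hP1]
  · have := Finset.sum_congr (rfl : (Finset.univ : Finset (ZMod n)) = _) (fun v _ => h1 v)
    simp only [Finset.sum_add_distrib, Finset.sum_ite_eq', Finset.mem_univ, if_true] at this
    show ∑ v, P1 v = _
    omega
  · have := Finset.sum_congr (rfl : (Finset.univ : Finset (ZMod n)) = _)
      (fun v _ => congrArg (· * q ^ v.val) (h1 v))
    simp only [add_mul, ite_mul, zero_mul, one_mul, Finset.sum_add_distrib, Finset.sum_ite_eq', Finset.mem_univ, if_true] at this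
    have h2 := pow_val_succ q n (by omega) e hn
    apply Nat.ModEq.add_right_cancel h2.symm
    exact this ▸ Nat.ModEq.refl _

theorem carry_lemma (q n : ℕ) [NeZero n] (hq : 2 ≤ q) (hn : 2 ≤ n) (P R : ZMod n → ℕ)
    (hP : ∑ v, P v = 2 * (q - 1)) (hR : ∑ v, R v = 2 * (q - 1))
    (h : ∑ v, P v * q ^ v.val ≡ ∑ v, R v * q ^ v.val [MOD q ^ n - 1]) :
    P = R ∨ ∃ e f, q ≤ P e ∧ q ≤ R f ∧
      ∀ v, P v + (if v = e + 1 then 1 else 0) + (if v = f then q else 0)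
        = R v + (if v = f + 1 then 1 else 0) + (if v = e then q else 0) := by
  have le_of : ∀ P : ZMod n → ℕ, ∑ v, P v = q - 1 → ∀ v, P v < q := by
    intro P hs v
    have := Finset.single_le_sum (f := P) (fun _ _ => Nat.zero_le _) (Finset.mem_univ v)
    omega
  have ne_of : ∀ P : ZMod n → ℕ, 0 < ∑ v, P v → ∃ v, P v ≠ 0 := by
    intro P hs
    by_contra hc
    push Not at hc
    simp [hc] at hs
  by_cases h1 : ∃ e, q ≤ P e
  · obtain ⟨e, he⟩ := h1
    obtain ⟨P1, a1, a2, a3⟩ := shift_lemma q n hq hn P hP e he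
    by_cases h2 : ∃ f, q ≤ R f
    · obtain ⟨f, hf⟩ := h2
      obtain ⟨R1, b1, b2, b3⟩ := shift_lemma q n hq hn R hR f hf
      right
      refine ⟨e, f, he, hf, fun v => ?_⟩
      have := digits_unique q n P1 R1 (le_of _ a2) (le_of _ b2) (ne_of _ (by omega)) (ne_of _ (by omega))
        (a3.symm.trans (h.trans b3))
      have c1 := a1 v
      have c2 := b1 v
      rw [this] at c1
      omega
    · push Not at h2
      have := digits_unique q n P1 R (le_of _ a2) h2 (ne_of _ (by omega)) (ne_of _ (by omega))
        (a3.symm.trans h)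
      rw [this] at a2; omega
  · push Not at h1
    by_cases h2 : ∃ f, q ≤ R f
    · obtain ⟨f, hf⟩ := h2
      obtain ⟨R1, b1, b2, b3⟩ := shift_lemma q n hq hn R hR f hf
      have := digits_unique q n P R1 h1 (le_of _ b2) (ne_of _ (by omega)) (ne_of _ (by omega))
        (h.trans b3)
      rw [← this] at b2; omega
    · push Not at h2
      left
      exact digits_unique q n P R h1 h2 (ne_of _ (by omega)) (ne_of _ (by omega)) h
set_option linter.unusedSimpArgs false

theorem exists_delta (n : ℕ) [NeZero n] (hn : 4 ≤ n) (S : ZMod n → Prop)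
    (hS : ∀ i, S i → ¬ S (-i)) (d : ZMod n) (hd : S d) (hd0 : d ≠ 0) :
    ∃ δ : ZMod n, δ ≠ 0 ∧ δ ≠ d ∧ δ ≠ -d ∧ ¬ (S (d + δ) ∧ S (d - δ)) := by
  by_contra hc
  push Not at hc
  have h2d : d ≠ -d := by
    intro h
    have := hS d hd
    rw [← h] at this
    exact this hd
  have h1 : ∀ y, y ≠ 0 → y ≠ d → y ≠ d + d → S y := by
    intro y h0 h1 h2
    have := (hc (y - d) (sub_ne_zero.2 h1) (fun h => h2 (by rw [← sub_eq_iff_eq_add.1 h]))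
      (fun h => h0 (by have := sub_eq_iff_eq_add.1 h; simpa using this))).1
    simpa using this
  have h3 : -d = d + d := by
    by_contra h
    exact hS d hd (h1 (-d) (by simpa using hd0) (fun h' => h2d h'.symm) h)
  have h4 : ∀ y, y = 0 ∨ y = d ∨ y = d + d := by
    intro y
    by_contra h
    push Not at h
    refine hS y (h1 y h.1 h.2.1 h.2.2) (h1 (-y) (by simpa using h.1) ?_ ?_)
    · intro h'; exact h.2.2 (by rw [← h3, ← h', neg_neg])
    · intro h'; exact h.2.1 (by rw [← h3] at h'; exact neg_injective h')
  have h5 : (Finset.univ : Finset (ZMod n)) ⊆ {0, d, d + d} := by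
    intro y _
    simpa using h4 y
  have h6 := Finset.card_le_card h5
  have h7 : ({0, d, d + d} : Finset (ZMod n)).card ≤ 3 := Finset.card_le_three
  rw [Finset.card_univ, ZMod.card] at h6
  omega

theorem mod_conv (M A B A' B' : ℕ) (hM : 1 ≤ M)
    (h : A' + (M - 1) * B' ≡ A + (M - 1) * B [MOD M]) : A' + B ≡ A + B' [MOD M] := by
  obtain ⟨c, rfl⟩ : ∃ c, M = c + 1 := ⟨M - 1, by omega⟩
  simp only [Nat.add_sub_cancel] at h
  have h1 := h.add_right (B + B')
  have e1 : A' + c * B' + (B + B') = (c + 1) * B' + (A' + B) := by ring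
  have e2 : A + c * B + (B + B') = (c + 1) * B + (A + B') := by ring
  rw [e1, e2] at h1
  simpa [Nat.ModEq] using h1

theorem ex_conv (q n M : ℕ) [NeZero n] (k : ZMod n × ZMod n → ℕ) :
    ∑ i, k i * (q ^ i.2.val + (M - 1) * q ^ i.1.val)
      = ∑ v, (∑ t, k (t, v)) * q ^ v.val + (M - 1) * ∑ v, (∑ h, k (v, h)) * q ^ v.val := by
  simp only [mul_add, Finset.sum_add_distrib]
  congr 1
  · rw [Fintype.sum_prod_type, Finset.sum_comm]
    simp only [Finset.sum_mul]
  · rw [Fintype.sum_prod_type, Finset.mul_sum]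
    refine Finset.sum_congr rfl fun v _ => ?_
    rw [Finset.sum_mul, Finset.mul_sum]
    refine Finset.sum_congr rfl fun h _ => ?_
    ring

theorem carry_k (q n : ℕ) [NeZero n] (hq : 2 ≤ q) (hn : 2 ≤ n) (k k0 : ZMod n × ZMod n → ℕ)
    (hk : ∑ i, k i = q - 1) (hk0 : ∑ i, k0 i = q - 1)
    (h : ∑ i, k i * (q ^ i.2.val + (q ^ n - 1 - 1) * q ^ i.1.val) ≡
      ∑ i, k0 i * (q ^ i.2.val + (q ^ n - 1 - 1) * q ^ i.1.val) [MOD q ^ n - 1]) :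
    (∀ v, ∑ t, k (t, v) + ∑ h, k0 (v, h) = ∑ t, k0 (t, v) + ∑ h, k (v, h)) ∨
    ∃ f e, q ≤ ∑ t, k (t, f) + ∑ h, k0 (f, h) ∧ q ≤ ∑ t, k0 (t, e) + ∑ h, k (e, h) ∧
      ∀ v, ∑ t, k (t, v) + ∑ h, k0 (v, h) + (if v = f + 1 then 1 else 0) + (if v = e then q else 0)
        = ∑ t, k0 (t, v) + ∑ h, k (v, h) + (if v = e + 1 then 1 else 0) + (if v = f then q else 0) := by
  rw [ex_conv, ex_conv] at h
  have hM : 1 ≤ q ^ n - 1 := by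
    have : 2 ^ 1 ≤ q ^ n := (Nat.pow_le_pow_left hq 1).trans (Nat.pow_le_pow_right (by omega) (by omega))
    omega
  have h1 := mod_conv _ _ _ _ _ hM h
  rw [← Finset.sum_add_distrib, ← Finset.sum_add_distrib] at h1
  simp only [← add_mul] at h1
  have s1 : ∀ k : ZMod n × ZMod n → ℕ, ∑ v, ∑ t, k (t, v) = ∑ i, k i := by
    intro k; rw [Fintype.sum_prod_type, Finset.sum_comm]
  have s2 : ∀ k : ZMod n × ZMod n → ℕ, ∑ v, ∑ h, k (v, h) = ∑ i, k i := by
    intro k; rw [Fintype.sum_prod_type]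
  rcases carry_lemma q n hq hn (fun v => ∑ t, k (t, v) + ∑ h, k0 (v, h))
    (fun v => ∑ t, k0 (t, v) + ∑ h, k (v, h))
    (by rw [Finset.sum_add_distrib, s1, s2]; omega) (by rw [Finset.sum_add_distrib, s1, s2]; omega) h1 with h2 | h2
  · left; intro v; exact congrFun h2 v
  · right; exact h2

theorem row_two (n : ℕ) [NeZero n] (k : ZMod n × ZMod n → ℕ) (u v : ZMod n) (huv : u ≠ v) :
    ∑ h, k (u, h) + ∑ h, k (v, h) ≤ ∑ i, k i := by
  rw [Fintype.sum_prod_type]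
  have : ({u, v} : Finset (ZMod n)) ⊆ Finset.univ := Finset.subset_univ _
  have := Finset.sum_le_sum_of_subset (f := fun x => ∑ h, k (x, h)) this
  rwa [Finset.sum_pair huv] at this

theorem col_two (n : ℕ) [NeZero n] (k : ZMod n × ZMod n → ℕ) (u v : ZMod n) (huv : u ≠ v) :
    ∑ t, k (t, u) + ∑ t, k (t, v) ≤ ∑ i, k i := by
  rw [Fintype.sum_prod_type, Finset.sum_comm]
  have : ({u, v} : Finset (ZMod n)) ⊆ Finset.univ := Finset.subset_univ _
  have := Finset.sum_le_sum_of_subset (f := fun x => ∑ t, k (t, x)) this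
  rwa [Finset.sum_pair huv] at this

theorem col_one (n : ℕ) [NeZero n] (k : ZMod n × ZMod n → ℕ) (u : ZMod n) :
    ∑ t, k (t, u) ≤ ∑ i, k i := by
  rw [Fintype.sum_prod_type, Finset.sum_comm]
  exact Finset.single_le_sum (f := fun x => ∑ t, k (t, x)) (fun _ _ => Nat.zero_le _) (Finset.mem_univ u)

theorem row_one (n : ℕ) [NeZero n] (k : ZMod n × ZMod n → ℕ) (u : ZMod n) :
    ∑ h, k (u, h) ≤ ∑ i, k i := by
  rw [Fintype.sum_prod_type]
  exact Finset.single_le_sum (f := fun x => ∑ h, k (x, h)) (fun _ _ => Nat.zero_le _) (Finset.mem_univ u)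

theorem row_col (n : ℕ) [NeZero n] (k : ZMod n × ZMod n → ℕ) (e f : ZMod n) :
    ∑ h, k (e, h) + ∑ t, k (t, f) ≤ ∑ i, k i + k (e, f) := by
  rw [Fintype.sum_prod_type]
  rw [← Finset.add_sum_erase Finset.univ (fun x => ∑ h, k (x, h)) (Finset.mem_univ e),
    ← Finset.add_sum_erase Finset.univ (fun t => k (t, f)) (Finset.mem_univ e)]
  have : ∑ x ∈ Finset.univ.erase e, k (x, f) ≤ ∑ x ∈ Finset.univ.erase e, ∑ h, k (x, h) := by
    refine Finset.sum_le_sum fun x _ => ?_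
    exact Finset.single_le_sum (f := fun h => k (x, h)) (fun _ _ => Nat.zero_le _) (Finset.mem_univ f)
  omega

theorem edge_unique (q n : ℕ) [NeZero n] (hq : 3 ≤ q) (hn : 2 ≤ n) (S : ZMod n → Prop)
    (d δ : ZMod n) (hd0 : d ≠ 0) (hdd : ¬ S (-d)) (h2d : d ≠ -d)
    (hδ0 : δ ≠ 0) (hδ1 : δ ≠ d) (hδ2 : δ ≠ -d) (hδ : ¬ (S (d + δ) ∧ S (d - δ)))
    (r s : ℕ) (hrs : r + s = q - 1) (h2r : 2 * r ≤ q) (h2s : 2 * s ≤ q)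
    (k k0 : ZMod n × ZMod n → ℕ)
    (hk0 : ∀ i, k0 i = (if i = (0, d) then r else 0) + (if i = (δ, δ + d) then s else 0))
    (hk : ∑ i, k i = q - 1) (hkS : ∀ t h, k (t, h) ≠ 0 → t ≠ h → S (h - t))
    (h : ∑ i, k i * (q ^ i.2.val + (q ^ n - 1 - 1) * q ^ i.1.val) ≡
      ∑ i, k0 i * (q ^ i.2.val + (q ^ n - 1 - 1) * q ^ i.1.val) [MOD q ^ n - 1]) : k = k0 := by
  have hk0s : ∑ i, k0 i = q - 1 := by
    simp only [hk0, Finset.sum_add_distrib, Finset.sum_ite_eq', Finset.mem_univ, if_true, hrs]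
  have hN : ∀ v, ∑ t, k0 (t, v) = (if v = d then r else 0) + (if v = δ + d then s else 0) := by
    intro v
    simp only [hk0, Finset.sum_add_distrib, Prod.mk.injEq, ite_and, Finset.sum_ite_eq', Finset.mem_univ, if_true]
  have hD : ∀ v, ∑ h, k0 (v, h) = (if v = 0 then r else 0) + (if v = δ then s else 0) := by
    intro v
    simp only [hk0, Finset.sum_add_distrib, Prod.mk.injEq, ite_and]
    congr 1 <;> split_ifs <;> simp
  -- distinctness
  have n1 : d ≠ δ + d := fun h => hδ0 (by simpa using h)
  have n2 : δ + d ≠ 0 := fun h => hδ2 (eq_neg_of_add_eq_zero_left h)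
  have n3 : δ + d ≠ δ := fun h => hd0 (by simpa using h)
  rcases carry_k q n (by omega) hn k k0 hk hk0s h with hx | ⟨f, e, h1, h2, hx⟩
  · -- no carry
    simp only [hN, hD] at hx
    have c1 := hx d
    have c2 := hx (δ + d)
    have c3 := hx 0
    have c4 := hx δ
    have cc := col_two n k d (δ + d) n1
    have rr := row_two n k 0 δ hδ0.symm
    simp only [hd0, hd0.symm, hδ0, hδ0.symm, hδ1, hδ1.symm, n1, n1.symm, n2, n2.symm, n3, n3.symm, if_true, if_false] at c1 c2 c3 c4
    have colz : ∀ v, v ≠ d → v ≠ δ + d → ∀ t, k (t, v) = 0 := by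
      intro v hv1 hv2 t
      have e1 : ∑ v, ∑ t, k (t, v) = q - 1 := by
        rw [Finset.sum_comm, ← Fintype.sum_prod_type]; exact hk
      have := Finset.sum_le_sum_of_subset (f := fun x => ∑ t, k (t, x)) (Finset.subset_univ ({v, d, δ + d} : Finset (ZMod n)))
      rw [Finset.sum_insert (by simp [hv1, hv2]), Finset.sum_pair n1, e1] at this
      have h0 := Finset.single_le_sum (f := fun t => k (t, v)) (fun _ _ => Nat.zero_le _) (Finset.mem_univ t)
      omega
    have rowz : ∀ v, v ≠ 0 → v ≠ δ → ∀ t, k (v, t) = 0 := by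
      intro v hv1 hv2 t
      have e1 : ∑ v, ∑ t, k (v, t) = q - 1 := by
        rw [← Fintype.sum_prod_type]; exact hk
      have := Finset.sum_le_sum_of_subset (f := fun x => ∑ t, k (x, t)) (Finset.subset_univ ({v, 0, δ} : Finset (ZMod n)))
      rw [Finset.sum_insert (by simp [hv1, hv2]), Finset.sum_pair hδ0.symm, e1] at this
      have h0 := Finset.single_le_sum (f := fun t => k (v, t)) (fun _ _ => Nat.zero_le _) (Finset.mem_univ t)
      omega
    have csum : ∀ v, ∑ t, k (t, v) = k (0, v) + k (δ, v) := by
      intro v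
      rw [← Finset.sum_pair (f := fun t => k (t, v)) hδ0.symm]
      symm
      apply Finset.sum_subset (Finset.subset_univ _)
      intro t _ ht
      simp at ht
      exact rowz t ht.1 ht.2 v
    have rsum : ∀ v, ∑ t, k (v, t) = k (v, d) + k (v, δ + d) := by
      intro v
      rw [← Finset.sum_pair (f := fun t => k (v, t)) n1]
      symm
      apply Finset.sum_subset (Finset.subset_univ _)
      intro t _ ht
      simp at ht
      exact colz t ht.1 ht.2 v
    rw [csum, rsum] at c1 c2 c3 c4
    rw [csum, csum] at cc
    rw [rsum, rsum] at rr
    have z1 := rowz d hd0 hδ1.symm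
    have z2 := rowz (δ + d) n2 n3
    have z3 := colz 0 hd0.symm n2.symm
    have z4 := colz δ hδ1 n3.symm
    rw [z1, z1] at c1
    rw [z2, z2] at c2
    rw [z3, z3] at c3
    rw [z4, z4] at c4
    have cross : k (0, δ + d) = 0 ∨ k (δ, d) = 0 := by
      by_contra hcon
      push Not at hcon
      apply hδ
      have a1 := hkS _ _ hcon.1 n2.symm
      have a2 := hkS _ _ hcon.2 hδ1
      rw [sub_zero, add_comm] at a1
      exact ⟨a1, a2⟩
    funext ⟨t, v⟩
    rw [hk0]
    simp only [Prod.mk.injEq]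
    by_cases ht0 : t = 0
    · subst ht0
      by_cases hv : v = d
      · subst hv; simp [hδ0.symm]; omega
      · by_cases hv2 : v = δ + d
        · subst hv2; simp [hδ0.symm, hδ0]; omega
        · simp [hv, hδ0.symm]; exact colz v hv hv2 _
    · by_cases ht : t = δ
      · subst ht
        by_cases hv : v = d
        · subst hv; simp [ht0]; omega
        · by_cases hv2 : v = t + d
          · subst hv2; simp [ht0]; omega
          · simp [ht0, hv2]; exact colz v hv hv2 _
      · simp [ht0, ht]; exact rowz t ht0 ht _
  · -- carry
    exfalso
    simp only [hN, hD] at hx h1 h2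
    have cf := col_one n k f
    have re := row_one n k e
    have ef := row_col n k e f
    have hf : f = 0 ∨ f = δ := by
      by_contra hcon
      push Not at hcon
      simp only [hcon.1, hcon.2, if_false] at h1
      omega
    have he : e = d ∨ e = δ + d := by
      by_contra hcon
      push Not at hcon
      simp only [hcon.1, hcon.2, if_false] at h2
      omega
    rcases hf with rfl | rfl <;> rcases he with rfl | rfl
    · simp only [hδ0.symm, n1, if_true, if_false] at h1 h2
      have := hkS e 0 (by omega) hd0
      exact hdd (by simpa using this)
    · simp only [hδ0.symm, n1.symm, if_true, if_false] at h1 h2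
      have c1 := hx d
      have c2 := hx δ
      have cc := col_two n k 0 d hd0.symm
      have rr := row_two n k (δ + d) δ n3
      simp only [hd0, hd0.symm, hδ0, hδ0.symm, hδ1, hδ1.symm, n1, n1.symm, n2, n2.symm, n3, n3.symm, if_true, if_false] at c1 c2
      have g1 : d = 0 + 1 := by
        by_contra hg
        rw [if_neg hg] at c1
        omega
      have g2 : δ = δ + d + 1 := by
        by_contra hg
        rw [if_neg hg] at c2
        omega
      apply h2d
      have : d + 1 = 0 := by rw [add_assoc] at g2; simpa using g2
      rw [eq_comm, neg_eq_iff_add_eq_zero]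
      calc d + d = d + 1 := by nth_rewrite 2 [g1]; simp
        _ = 0 := this
    · simp only [hδ0, n1, if_true, if_false] at h1 h2
      have c1 := hx (f + e)
      have c2 := hx 0
      have cc := col_two n k f (f + e) n3.symm
      have rr := row_two n k e 0 hd0
      simp only [hd0, hd0.symm, hδ0, hδ0.symm, hδ1, hδ1.symm, n1, n1.symm, n2, n2.symm, n3, n3.symm, if_true, if_false] at c1 c2
      have g1 : f + e = f + 1 := by
        by_contra hg
        rw [if_neg hg] at c1
        omega
      have g2 : 0 = e + 1 := by
        by_contra hg
        rw [if_neg hg] at c2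
        omega
      apply h2d
      have g3 : e = 1 := by simpa using g1
      rw [eq_comm, neg_eq_iff_add_eq_zero]
      nth_rewrite 2 [g3]; exact g2.symm
    · simp only [hδ0, n1.symm, if_true, if_false] at h1 h2
      have := hkS (f + d) f (by omega) n3
      exact hdd (by simpa using this)

theorem edge_unique_two (n : ℕ) [NeZero n] (hn : 2 ≤ n) (d : ZMod n) (hd0 : d ≠ 0)
    (k k0 : ZMod n × ZMod n → ℕ)
    (hk0 : ∀ i, k0 i = (if i = (0, d) then 1 else 0))
    (hk : ∑ i, k i = 2 - 1)
    (h : ∑ i, k i * (2 ^ i.2.val + (2 ^ n - 1 - 1) * 2 ^ i.1.val) ≡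
      ∑ i, k0 i * (2 ^ i.2.val + (2 ^ n - 1 - 1) * 2 ^ i.1.val) [MOD 2 ^ n - 1]) : k = k0 := by
  have hk0s : ∑ i, k0 i = 2 - 1 := by simp [hk0]
  obtain ⟨⟨a, b⟩, hab⟩ : ∃ j, k = fun i => if i = j then 1 else 0 := by
    have h1 : ∃ j, k j ≠ 0 := by
      by_contra hc
      push Not at hc
      simp [hc] at hk
    obtain ⟨j, hj⟩ := h1
    refine ⟨j, funext fun i => ?_⟩
    have h2 := Finset.add_sum_erase Finset.univ k (Finset.mem_univ j)
    split_ifs with hi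
    · subst hi; omega
    · have h3 := Finset.single_le_sum (f := k) (fun _ _ => Nat.zero_le _) (Finset.mem_erase.2 ⟨hi, Finset.mem_univ i⟩)
      omega
  have hN : ∀ v, ∑ t, k0 (t, v) = (if v = d then 1 else 0) := by
    intro v; simp only [hk0, Prod.mk.injEq, ite_and, Finset.sum_ite_eq', Finset.mem_univ, if_true]
  have hD : ∀ v, ∑ h, k0 (v, h) = (if v = 0 then 1 else 0) := by
    intro v; simp only [hk0, Prod.mk.injEq, ite_and]
    split_ifs <;> simp
  have hN' : ∀ v, ∑ t, k (t, v) = (if v = b then 1 else 0) := by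
    intro v; simp only [hab, Prod.mk.injEq, ite_and, Finset.sum_ite_eq', Finset.mem_univ, if_true]
  have hD' : ∀ v, ∑ h, k (v, h) = (if v = a then 1 else 0) := by
    intro v; simp only [hab, Prod.mk.injEq, ite_and]
    split_ifs <;> simp
  rcases carry_k 2 n (by omega) hn k k0 hk hk0s h with hx | ⟨f, e, h1, h2, hx⟩
  · simp only [hN, hD, hN', hD'] at hx
    have c1 := hx d
    have c2 := hx 0
    simp only [hd0, hd0.symm, if_true, if_false] at c1 c2
    have hb : d = b := by
      by_contra hb
      rw [if_neg hb] at c1; omega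
    have ha : 0 = a := by
      by_contra ha
      rw [if_neg ha] at c2; split_ifs at c2 <;> omega
    funext i
    rw [hk0, hab, ← hb, ← ha]
  · exfalso
    simp only [hN, hD, hN', hD'] at hx h1 h2
    have hf : f = b ∧ f = 0 := by split_ifs at h1 <;> first | omega | exact ⟨by assumption, by assumption⟩
    have he : e = d ∧ e = a := by split_ifs at h2 <;> first | omega | exact ⟨by assumption, by assumption⟩
    obtain ⟨hf1, hf2⟩ := hf
    obtain ⟨he1, he2⟩ := he
    have c := hx (f + 1)
    rw [← hf1, ← hf2, ← he1, ← he2] at c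
    have hne : f ≠ e := by rw [hf2, he1]; exact hd0.symm
    have hne2 : f + 1 ≠ e + 1 := fun h => hne (by simpa using h)
    rw [if_neg hne2] at c
    simp only [if_true] at c
    split_ifs at c <;> omega

theorem num1 (q n ell P f : ℕ) (hq : 3 ≤ q) (hn : 2 ≤ n) (hex : ¬ (q = 3 ∧ n = 2)) (hell : 1 ≤ ell)
    (h1 : q ^ n - 1 ≤ ell * (P + 1)) (hP : P * P ≤ q ^ n) (hf1 : f * f ≤ 4 * q ^ n)
    (hf2 : 4 * q ^ n < (f + 1) * (f + 1)) (hb : (q - 1) * (ell - 1) * f < 2 * q ^ n) : False := by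
  have h2P : 2 * P ≤ f := by
    by_contra h
    have : f + 1 ≤ 2 * P := by omega
    have := Nat.mul_le_mul this this
    nlinarith
  obtain ⟨y, rfl⟩ : ∃ y, ell = y + 1 := ⟨ell - 1, by omega⟩
  simp only [Nat.add_sub_cancel] at hb
  have h2 : 2 * q ^ n ≤ y * f + 2 * y + 4 + f := by
    have : (y + 1) * (2 * P) ≤ (y + 1) * f := Nat.mul_le_mul_left _ h2P
    have h3 : q ^ n ≤ (y + 1) * (P + 1) + 1 := by omega
    nlinarith
  rcases Nat.lt_or_ge q 4 with h4 | h4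
  · have hq3 : q = 3 := by omega
    subst hq3
    have hQ : 27 ≤ 3 ^ n := by
      have : 3 ^ 3 ≤ 3 ^ n := Nat.pow_le_pow_right (by omega) (by omega)
      simpa using this
    generalize 3 ^ n = Q at *
    have hf : 10 ≤ f := by
      by_contra h
      have : f + 1 ≤ 10 := by omega
      have := Nat.mul_le_mul this this
      omega
    have a1 : y * 10 ≤ y * f := Nat.mul_le_mul_left _ hf
    have a2 : 2 * (y * f) < 2 * Q := by simpa [mul_assoc] using hb
    have a3 : 5 * f ≤ Q + 25 := by
      zify at *
      nlinarith [sq_nonneg ((f : ℤ) - 10)]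
    omega
  · have hQ : 16 ≤ q ^ n := by
      have : 4 ^ 2 ≤ q ^ n := (Nat.pow_le_pow_left h4 2).trans (Nat.pow_le_pow_right (by omega) hn)
      simpa using this
    have hb' : 3 * (y * f) < 2 * q ^ n := by
      have : 3 * (y * f) ≤ (q - 1) * (y * f) := Nat.mul_le_mul_right _ (by omega)
      rw [mul_assoc] at hb
      omega
    generalize q ^ n = Q at *
    have hf : 8 ≤ f := by
      by_contra h
      have : f + 1 ≤ 8 := by omega
      have := Nat.mul_le_mul this this
      omega
    have a1 : y * 8 ≤ y * f := Nat.mul_le_mul_left _ hf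
    have a3 : 4 * f ≤ Q + 16 := by
      zify at *
      nlinarith [sq_nonneg ((f : ℤ) - 8)]
    omega

theorem num2 (q ell f : ℕ) (hq : 5 ≤ q) (hell : q - 1 ≤ ell)
    (hf2 : 4 * q ^ 3 < (f + 1) * (f + 1)) (hb : (q - 1) * (ell - 1) * f < 2 * q ^ 3) : False := by
  obtain ⟨c, rfl⟩ : ∃ c, q = c + 5 := ⟨q - 5, by omega⟩
  have h1 : (c + 4) * (c + 3) * f < 2 * (c + 5) ^ 3 := by
    refine lt_of_le_of_lt ?_ hb
    exact Nat.mul_le_mul_right _ (Nat.mul_le_mul (by omega) (by omega))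
  have h2 : 6 * f < 25 * (c + 5) := by
    have h3 : 12 * (c + 5) ^ 2 * f ≤ 25 * ((c + 4) * (c + 3) * f) := by
      rw [← mul_assoc]
      apply Nat.mul_le_mul_right
      nlinarith
    have h4 : 2 * (c + 5) ^ 2 * (6 * f) < 2 * (c + 5) ^ 2 * (25 * (c + 5)) := by nlinarith
    exact Nat.lt_of_mul_lt_mul_left h4
  have h5 : 6 * (f + 1) ≤ 25 * c + 130 := by omega
  have h6 := Nat.mul_le_mul h5 h5
  nlinarith [Nat.zero_le (c * c * c), Nat.zero_le (c * c)]

theorem antisym_aux (p m n A B i i' u v j : ℕ) (hn : 1 ≤ n) (hm : 1 ≤ m) (hp : 2 ≤ p)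
    (hi : i + i' = n) (hA1 : 1 ≤ A) (hB1 : 1 ≤ B) 
    (hA : A ≡ j * ((p ^ m) ^ i - 1) * p ^ u [MOD (p ^ m) ^ n - 1])
    (hB : B ≡ j * ((p ^ m) ^ i' - 1) * p ^ v [MOD (p ^ m) ^ n - 1]) :
    ∃ P, P * P ≤ (p ^ m) ^ n ∧
      ((p ^ m) ^ n - 1 ≤ A * P + B ∨ (p ^ m) ^ n - 1 ≤ A + B * P) := by
  set μ := m * n with hμ
  have hμ1 : 1 ≤ μ := Nat.mul_pos hm hn
  have hQ : (p ^ m) ^ n = p ^ μ := by rw [← pow_mul]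
  rw [hQ] at hA hB ⊢
  set M := p ^ μ - 1 with hM
  have hQ1 : 1 ≤ p ^ μ := Nat.one_le_pow _ _ (by omega)
  have hper : p ^ μ ≡ 1 [MOD M] := by
    have : p ^ μ = 1 + M := by omega
    rw [this]; simp [Nat.ModEq]
  have hperk : ∀ k, p ^ (μ * k) ≡ 1 [MOD M] := by
    intro k; rw [pow_mul]; simpa using hper.pow k
  have hred : ∀ w, p ^ w ≡ p ^ (w % μ) [MOD M] := by
    intro w
    conv_lhs => rw [← Nat.div_add_mod w μ, pow_add]
    simpa using (hperk (w / μ)).mul_right (p ^ (w % μ))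
  have h0 : j * ((p ^ m) ^ i - 1) + j * ((p ^ m) ^ i' - 1) * (p ^ m) ^ i ≡ 0 [MOD M] := by
    obtain ⟨x, hx⟩ : ∃ x, (p ^ m) ^ i = x + 1 :=
      ⟨(p ^ m) ^ i - 1, by have := Nat.one_le_pow i (p ^ m) (Nat.pow_pos (by omega)); omega⟩
    obtain ⟨y, hy⟩ : ∃ y, (p ^ m) ^ i' = y + 1 :=
      ⟨(p ^ m) ^ i' - 1, by have := Nat.one_le_pow i' (p ^ m) (Nat.pow_pos (by omega)); omega⟩
    have hxy : p ^ μ = (x + 1) * (y + 1) := by rw [← hx, ← hy, ← pow_add, hi, hQ]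
    have : M = x * y + x + y := by
      rw [hM, hxy]
      have : (x + 1) * (y + 1) = x * y + x + y + 1 := by ring
      omega
    rw [Nat.modEq_zero_iff_dvd, hx, hy]
    refine ⟨j, ?_⟩
    simp only [Nat.add_sub_cancel]
    rw [this]; ring
  -- A + B * p^W ≡ 0
  obtain ⟨z, hz⟩ : ∃ z, μ ∣ v + z := ⟨v * (μ - 1), v, by
    obtain ⟨c, hc⟩ : ∃ c, μ = c + 1 := ⟨μ - 1, by omega⟩
    rw [hc]; simp; ring⟩
  have hW : A + B * p ^ (u + m * i + z) ≡ 0 [MOD M] := by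
    have e1 : A * p ^ (v + z) ≡ A [MOD M] := by
      obtain ⟨c, hc⟩ := hz
      rw [hc]
      simpa using (hperk c).mul_left A
    have e2 : A * p ^ (v + z) + B * p ^ (u + m * i + z) ≡
        (j * ((p ^ m) ^ i - 1) * p ^ u) * p ^ (v + z) +
          (j * ((p ^ m) ^ i' - 1) * p ^ v) * p ^ (u + m * i + z) [MOD M] :=
      (hA.mul_right _).add (hB.mul_right _)
    have e3 : (j * ((p ^ m) ^ i - 1) * p ^ u) * p ^ (v + z) +
          (j * ((p ^ m) ^ i' - 1) * p ^ v) * p ^ (u + m * i + z) =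
        (j * ((p ^ m) ^ i - 1) + j * ((p ^ m) ^ i' - 1) * (p ^ m) ^ i) * p ^ (u + v + z) := by
      simp only [pow_add, pow_mul]; ring
    rw [e3] at e2
    have e4 := h0.mul_right (p ^ (u + v + z))
    rw [zero_mul] at e4
    exact ((e1.symm.add_right _).trans e2).trans e4
  set w := (u + m * i + z) % μ with hw
  have hwlt : w < μ := Nat.mod_lt _ hμ1
  have hW2 : A + B * p ^ w ≡ 0 [MOD M] :=
    (((hred _).mul_left B).add_left A).symm.trans hW
  rcases Nat.lt_or_ge μ (2 * w) with h | h
  · refine ⟨p ^ (μ - w), ?_, Or.inl ?_⟩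
    · rw [← pow_add]; exact Nat.pow_le_pow_right (by omega) (by omega)
    · have h3 := hW2.mul_right (p ^ (μ - w))
      have e : (A + B * p ^ w) * p ^ (μ - w) = A * p ^ (μ - w) + B * p ^ μ := by
        rw [add_mul, mul_assoc, ← pow_add, Nat.add_sub_cancel' hwlt.le]
      rw [e, zero_mul] at h3
      have h4 : A * p ^ (μ - w) + B ≡ 0 [MOD M] := by
        have := ((hper.mul_left B).add_left (A * p ^ (μ - w))).symm.trans h3
        simpa using this
      exact Nat.le_of_dvd (by omega) ((Nat.modEq_zero_iff_dvd).1 h4)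
  · refine ⟨p ^ w, ?_, Or.inr ?_⟩
    · rw [← pow_add]; exact Nat.pow_le_pow_right (by omega) (by omega)
    · exact Nat.le_of_dvd (by omega) ((Nat.modEq_zero_iff_dvd).1 hW2)

theorem choose_ne_zero (p m : ℕ) (hp : p.Prime) (E : Type*) [Field E] [CharP E p] (r : ℕ)
    (hr : r < p ^ m) : ((p ^ m - 1).choose r : E) = (-1) ^ r := by
  induction r with
  | zero => simp
  | succ r ih =>
    have h1 : p ∣ (p ^ m).choose (r + 1) := hp.dvd_choose_pow (by omega) (by omega)
    have h2 : ((p ^ m).choose (r + 1) : E) = 0 := (CharP.cast_eq_zero_iff E p _).2 h1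
    have h3 : (p ^ m).choose (r + 1) = (p ^ m - 1).choose r + (p ^ m - 1).choose (r + 1) := by
      conv_lhs => rw [show p ^ m = (p ^ m - 1) + 1 by omega]
      exact Nat.choose_succ_succ _ _
    rw [h3] at h2
    push_cast at h2
    rw [ih (by omega)] at h2
    rw [pow_succ]
    linear_combination h2

theorem multinomial_two {ι : Type*} [Fintype ι] [DecidableEq ι] (a b : ι) (hab : a ≠ b) (r s : ℕ)
    (k : ι → ℕ) (hk : ∀ i, k i = (if i = a then r else 0) + (if i = b then s else 0)) :
    Nat.multinomial Finset.univ k = (r + s).choose r ∧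
    ∀ (E : Type*) [Field E] (w : ι → E), ∏ i, w i ^ k i = w a ^ r * w b ^ s := by
  have ka : k a = r := by rw [hk]; simp [hab]
  have kb : k b = s := by rw [hk]; simp [hab.symm]
  have kz : ∀ i, i ≠ a → i ≠ b → k i = 0 := by intro i h1 h2; rw [hk]; simp [h1, h2]
  have hsum : ∑ i, k i = r + s := by simp [hk, Finset.sum_add_distrib]
  constructor
  · unfold Nat.multinomial
    rw [hsum, Nat.choose_eq_factorial_div_factorial (by omega), Nat.add_sub_cancel_left]
    congr 1
    rw [← Finset.prod_subset (Finset.subset_univ ({a, b} : Finset ι)), Finset.prod_pair hab, ka, kb]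
    intro i _ hi
    simp at hi
    rw [kz i hi.1 hi.2]; simp
  · intro E _ w
    rw [← Finset.prod_subset (Finset.subset_univ ({a, b} : Finset ι)), Finset.prod_pair hab, ka, kb]
    intro i _ hi
    simp at hi
    rw [kz i hi.1 hi.2]; simp

theorem T_expand (p m q n : ℕ) (hq : q = p ^ m) (E : Type*) [Field E] [ExpChar E p] (a : ℕ → E) (x : E) :
    ∑ j ∈ Finset.range n, ((∑ i ∈ Finset.range n, a i * x ^ q ^ i) / x) ^ q ^ j
      = ∑ j ∈ Finset.range n, ∑ i ∈ Finset.range n, a i ^ q ^ j * x ^ q ^ (i + j) * x⁻¹ ^ q ^ j := by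
  refine Finset.sum_congr rfl fun j _ => ?_
  rw [div_eq_mul_inv, Finset.sum_mul, hq, ← pow_mul, sum_pow_char_pow]
  refine Finset.sum_congr rfl fun i _ => ?_
  rw [mul_pow, mul_pow, ← pow_mul x, ← pow_mul, ← pow_mul, ← pow_add, ← mul_add]

theorem range_zmod {E : Type*} [AddCommMonoid E] (n : ℕ) [NeZero n] (F : ℕ → E) :
    ∑ i ∈ Finset.range n, F i = ∑ v : ZMod n, F v.val := by
  obtain ⟨n', rfl⟩ : ∃ n', n = n' + 1 := ⟨n - 1, by have := NeZero.ne n; omega⟩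
  rw [← Fin.sum_univ_eq_sum_range]
  rfl

theorem inv_pow_card {E : Type*} [Field E] [Fintype E] (x : E) (hx : x ≠ 0) (k : ℕ) :
    x⁻¹ ^ k = x ^ ((Fintype.card E - 1 - 1) * k) := by
  have h2 := Fintype.one_lt_card (α := E)
  have : x⁻¹ = x ^ (Fintype.card E - 1 - 1) := by
    symm
    apply eq_inv_of_mul_eq_one_left
    rw [← pow_succ, Nat.sub_add_cancel (by omega)]
    exact FiniteField.pow_card_sub_one_eq_one x hx
  rw [this, pow_mul]

theorem T_edges (p m q n : ℕ) [NeZero n] (hq : q = p ^ m) (E : Type*) [Field E] [Fintype E]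
    [ExpChar E p] (hE : Fintype.card E = q ^ n) (a : ℕ → E) (x : E) (hx : x ≠ 0) :
    ∑ j ∈ Finset.range n, ((∑ i ∈ Finset.range n, a i * x ^ q ^ i) / x) ^ q ^ j
      = ∑ i : ZMod n × ZMod n, a (i.2 - i.1).val ^ q ^ i.1.val *
          x ^ (q ^ i.2.val + (q ^ n - 1 - 1) * q ^ i.1.val) := by
  rw [T_expand p m q n hq, Fintype.sum_prod_type, range_zmod]
  refine Finset.sum_congr rfl fun t _ => ?_
  rw [range_zmod, ← Equiv.sum_comp (Equiv.subRight t)]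
  refine Finset.sum_congr rfl fun h _ => ?_
  simp only [Equiv.subRight_apply]
  rw [inv_pow_card x hx, hE, mul_assoc, pow_add x]
  congr 2
  have e : ((h - t).val + t.val) % n = h.val := by
    rw [← ZMod.val_add]; simp
  rw [← e]
  conv_lhs => rw [← Nat.div_add_mod ((h - t).val + t.val) n]
  have hk : ∀ c : ℕ, x ^ (q ^ n) ^ c = x := by
    intro c
    rw [← hE]; exact FiniteField.pow_card_pow c x
  rw [pow_add, pow_mul, pow_mul, hk]

theorem lead_facts (p m q n : ℕ) (hp : p.Prime) (hm : 1 ≤ m) (hq : q = p ^ m) (hn : 2 ≤ n)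
    {E : Type*} [Field E] (a : ℕ → E) (ell : ℕ)
    (hell : ell = sInf {w : ℕ | ∃ j : ℕ, 1 ≤ j ∧ j ≤ q ^ n - 2 ∧
        Nat.gcd j (q ^ n - 1) = 1 ∧
        w = sSup {k : ℕ | ∃ i : ℕ, 1 ≤ i ∧ i ≤ n - 1 ∧ a i ≠ 0 ∧
            k = leadFn p (q ^ n - 1) (j * (q ^ i - 1) % (q ^ n - 1))}}) :
    ∃ j, ∀ i, 1 ≤ i → i ≤ n - 1 → a i ≠ 0 → ∃ A u, A ≡ j * (q ^ i - 1) * p ^ u [MOD q ^ n - 1] ∧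
      1 ≤ A ∧ A ≤ ell ∧ q - 1 ≤ A := by
  have hq2 : 2 ≤ q := by
    rw [hq]; exact hp.two_le.trans (Nat.le_self_pow (by omega) p)
  have hQ : 4 ≤ q ^ n := by
    have : 2 ^ 2 ≤ q ^ n := (Nat.pow_le_pow_left hq2 2).trans (Nat.pow_le_pow_right (by omega) hn)
    simpa using this
  have hne : {w : ℕ | ∃ j : ℕ, 1 ≤ j ∧ j ≤ q ^ n - 2 ∧
        Nat.gcd j (q ^ n - 1) = 1 ∧
        w = sSup {k : ℕ | ∃ i : ℕ, 1 ≤ i ∧ i ≤ n - 1 ∧ a i ≠ 0 ∧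
            k = leadFn p (q ^ n - 1) (j * (q ^ i - 1) % (q ^ n - 1))}}.Nonempty :=
    ⟨_, 1, le_refl _, by omega, by simp, rfl⟩
  have hmem := Nat.sInf_mem hne
  rw [← hell] at hmem
  obtain ⟨j, _, _, hj, hs⟩ := hmem
  refine ⟨j, fun i hi1 hi2 hai => ?_⟩
  have hne2 : {k : ℕ | ∃ u : ℕ, k % (q ^ n - 1) =
      (j * (q ^ i - 1) % (q ^ n - 1)) * p ^ u % (q ^ n - 1)}.Nonempty :=
    ⟨(j * (q ^ i - 1) % (q ^ n - 1)) * p ^ 0, 0, rfl⟩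
  have hmem2 := Nat.sInf_mem hne2
  obtain ⟨u, hu⟩ := hmem2
  change (leadFn p (q ^ n - 1) (j * (q ^ i - 1) % (q ^ n - 1))) % _ = _ at hu
  have hcong : leadFn p (q ^ n - 1) (j * (q ^ i - 1) % (q ^ n - 1)) ≡
      j * (q ^ i - 1) * p ^ u [MOD q ^ n - 1] := by
    have h1 : leadFn p (q ^ n - 1) (j * (q ^ i - 1) % (q ^ n - 1)) ≡
      (j * (q ^ i - 1) % (q ^ n - 1)) * p ^ u [MOD q ^ n - 1] := hu
    exact h1.trans ((Nat.mod_modEq _ _).mul_right _)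
  have hle : leadFn p (q ^ n - 1) (j * (q ^ i - 1) % (q ^ n - 1)) ≤ ell := by
    rw [hs]
    apply le_csSup
    · apply Set.Finite.bddAbove
      apply ((Finset.range n).finite_toSet.image
        (fun i => leadFn p (q ^ n - 1) (j * (q ^ i - 1) % (q ^ n - 1)))).subset
      rintro k ⟨i, h1, h2, h3, rfl⟩
      exact ⟨i, by simp; omega, rfl⟩
    · exact ⟨i, hi1, hi2, hai, rfl⟩
  generalize leadFn p (q ^ n - 1) (j * (q ^ i - 1) % (q ^ n - 1)) = A at *
  have hqi : 1 < q ^ i := Nat.one_lt_pow (by omega) (by omega)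
  have hqin : q ^ i < q ^ n := Nat.pow_lt_pow_right (by omega) (by omega)
  have hA1 : 1 ≤ A := by
    by_contra h0
    have h0' : A = 0 := by omega
    rw [h0'] at hcong
    have hdvd := (Nat.modEq_zero_iff_dvd).1 hcong.symm
    have hcp : Nat.Coprime (q ^ n - 1) (p ^ u) := by
      apply Nat.Coprime.pow_right
      rw [Nat.coprime_comm, hp.coprime_iff_not_dvd]
      intro hd
      have hd2 : p ∣ q ^ n := by
        rw [hq, ← pow_mul]; exact dvd_pow_self p (Nat.mul_ne_zero (by omega) (by omega))
      have := (Nat.dvd_sub hd2 hd)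
      rw [show q ^ n - (q ^ n - 1) = 1 by omega] at this
      exact hp.one_lt.ne' (Nat.dvd_one.1 this)
    have h2 := hcp.dvd_of_dvd_mul_right hdvd
    have h3 : Nat.Coprime (q ^ n - 1) j := by rw [Nat.coprime_comm]; exact hj
    have h4 := h3.dvd_of_dvd_mul_left h2
    have := Nat.le_of_dvd (by omega) h4
    omega
  refine ⟨A, u, hcong, hA1, hle, ?_⟩
  have hd1 : ∀ k, q - 1 ∣ q ^ k - 1 := fun k => by
    simpa using Nat.sub_dvd_pow_sub_pow q 1 k
  have h5 := hcong.of_dvd (hd1 n)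
  have h6 : j * (q ^ i - 1) * p ^ u ≡ 0 [MOD q - 1] :=
    (Nat.modEq_zero_iff_dvd).2 (((hd1 i).mul_left j).mul_right _)
  exact Nat.le_of_dvd hA1 ((Nat.modEq_zero_iff_dvd).1 (h5.trans h6))

theorem bound_facts (q n ell : ℕ) (hq : 1 ≤ q) (hell : 1 ≤ ell)
    (hbound : (q : ℝ) ^ n + 1 -
        (((q : ℝ) - 1) * ((ell : ℝ) - 1) / 2) * (⌊2 * Real.sqrt ((q : ℝ) ^ n)⌋₊ : ℝ) > 1) :
    ∃ f : ℕ, f * f ≤ 4 * q ^ n ∧ 4 * q ^ n < (f + 1) * (f + 1) ∧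
      (q - 1) * (ell - 1) * f < 2 * q ^ n := by
  set f := ⌊2 * Real.sqrt ((q : ℝ) ^ n)⌋₊ with hf
  have h0 : (0 : ℝ) ≤ 2 * Real.sqrt ((q : ℝ) ^ n) := by positivity
  have h1 := Nat.floor_le h0
  have h2 := Nat.lt_floor_add_one (2 * Real.sqrt ((q : ℝ) ^ n))
  rw [← hf] at h1 h2
  have hs : Real.sqrt ((q : ℝ) ^ n) * Real.sqrt ((q : ℝ) ^ n) = (q : ℝ) ^ n :=
    Real.mul_self_sqrt (by positivity)
  refine ⟨f, ?_, ?_, ?_⟩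
  · have : (f : ℝ) * f ≤ 4 * (q : ℝ) ^ n := by
      have := mul_le_mul h1 h1 (by positivity) h0
      linarith
    exact_mod_cast this
  · have : 4 * (q : ℝ) ^ n < ((f : ℝ) + 1) * (f + 1) := by
      have := mul_lt_mul'' h2 h2 h0 h0
      linarith
    exact_mod_cast this
  · have : ((q - 1 : ℕ) : ℝ) * ((ell - 1 : ℕ) : ℝ) * f < 2 * (q : ℝ) ^ n := by
      rw [Nat.cast_sub hq, Nat.cast_sub hell]
      push_cast
      linarith
    exact_mod_cast this

theorem exc_case (p m q n d : ℕ) (hq : q = p ^ m) (hq2 : 2 ≤ q) (E : Type*) [Field E] [Fintype E]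
    [CharP E p] [ExpChar E p] (hp : p.Prime)
    (hE : Fintype.card E = q ^ (n + 1)) (a : ℕ → E) (had : a d ≠ 0) (hd1 : 1 ≤ d) (hdn : d < n + 1)
    (haz : ∀ i, i < n + 1 → i ≠ 0 → i ≠ d → a i = 0)
    (hTr : ∑ j ∈ Finset.range (n + 1), (a 0) ^ q ^ j ≠ 0)
    (hT : ∀ x : E, x ≠ 0 →
      (∑ j ∈ Finset.range (n + 1), ((∑ i ∈ Finset.range (n + 1), a i * x ^ q ^ i) / x) ^ q ^ j) ^ (q - 1) = 1)
    (hnd : ¬ (q ^ (n + 1) - 1) ∣ q ^ d - 1)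
    (hun : ∀ (k0 : ℕ) (k : Fin (n + 1) → ℕ), k0 + ∑ c, k c = q - 1 →
      (∑ c, k c * ((q ^ d - 1) * q ^ (c : ℕ))) ≡ q ^ d - 1 [MOD q ^ (n + 1) - 1] →
      k0 = q - 2 ∧ ∀ c, k c = if c = 0 then 1 else 0) : False := by
  have key := multinomial_two (none : Option (Fin (n + 1))) (some 0) (by simp) (q - 2) 1
    (fun i => (if i = none then q - 2 else 0) + (if i = some 0 then 1 else 0)) (fun i => rfl)
  refine core_A (E := E) (ι := Option (Fin (n + 1))) (q - 1)
    (fun o => o.elim (∑ j ∈ Finset.range (n + 1), (a 0) ^ q ^ j) (fun c => a d ^ q ^ (c : ℕ)))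
    (fun o => o.elim 0 (fun c => (q ^ d - 1) * q ^ (c : ℕ))) ?_
    (fun i => (if i = none then q - 2 else 0) + (if i = some 0 then 1 else 0)) ?_ ?_ ?_ ?_
  · intro x hx
    rw [← hT x hx]
    congr 1
    rw [T_expand p m q _ hq, Fintype.sum_option]
    simp only [Option.elim]
    rw [pow_zero, mul_one, Fin.sum_univ_eq_sum_range (fun c => a d ^ q ^ c * x ^ ((q ^ d - 1) * q ^ c)),
      ← Finset.sum_add_distrib]
    refine Finset.sum_congr rfl fun j _ => ?_
    rw [← Finset.sum_subset (s₁ := {0, d}), Finset.sum_pair (by omega)]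
    · congr 1
      · rw [zero_add, mul_assoc, ← mul_pow, mul_inv_cancel₀ hx, one_pow, mul_one]
      · rw [mul_assoc]
        congr 1
        have h1 : q ^ (d + j) = (q ^ d - 1) * q ^ j + q ^ j := by
          have : 1 ≤ q ^ d := Nat.one_le_pow _ _ (by omega)
          rw [pow_add, Nat.sub_mul, one_mul, Nat.sub_add_cancel (Nat.le_mul_of_pos_left _ (by omega))]
        rw [h1, pow_add, mul_assoc, ← mul_pow, mul_inv_cancel₀ hx, one_pow, mul_one]
    · intro i hi
      simp at hi ⊢
      omega
    · intro i hi1 hi2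
      simp at hi1 hi2
      rw [haz i (by omega) hi2.1 hi2.2, zero_pow (by positivity)]
      simp
  · simp [Fintype.sum_option]; omega
  · rw [hE]
    simpa [Fintype.sum_option] using hnd
  · rw [key.1, key.2 E]
    have : q - 2 + 1 = p ^ m - 1 := by omega
    rw [this, choose_ne_zero p m hp E _ (by omega)]
    refine mul_ne_zero (pow_ne_zero _ (by simp)) (mul_ne_zero (pow_ne_zero _ hTr) (pow_ne_zero _ ?_))
    exact pow_ne_zero _ had
  · intro k hk _ hmod
    rw [Fintype.sum_option] at hk
    rw [hE, Fintype.sum_option, Fintype.sum_option] at hmod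
    simp at hmod
    obtain ⟨h1, h2⟩ := hun (k none) (fun c => k (some c)) hk hmod
    funext o
    cases o with
    | none => simp [h1]
    | some c => simp [h2 c]

theorem two_edges (p m q n : ℕ) [NeZero n] (hp : p.Prime) (hq : q = p ^ m) (hq3 : 3 ≤ q) (hn : 4 ≤ n)
    (E : Type*) [Field E] [Fintype E] [CharP E p] [ExpChar E p] (hE : Fintype.card E = q ^ n)
    (a : ℕ → E) (i0 : ℕ) (hi1 : 1 ≤ i0) (hi2 : i0 ≤ n - 1) (hai : a i0 ≠ 0)
    (hanti : ∀ i, 1 ≤ i → i ≤ n - 1 → a i ≠ 0 → a (n - i) = 0)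
    (hT : ∀ x : E, x ≠ 0 →
      (∑ j ∈ Finset.range n, ((∑ i ∈ Finset.range n, a i * x ^ q ^ i) / x) ^ q ^ j) ^ (q - 1) = 1) :
    False := by
  set S : ZMod n → Prop := fun v => v ≠ 0 ∧ a v.val ≠ 0 with hSdef
  have hS : ∀ i, S i → ¬ S (-i) := by
    rintro i ⟨h1, h2⟩ ⟨h3, h4⟩
    have : NeZero i := ⟨h1⟩
    rw [ZMod.val_neg_of_ne_zero] at h4
    have hv : i.val ≠ 0 := by rwa [Ne, ZMod.val_eq_zero]
    have := ZMod.val_lt i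
    exact h4 (hanti _ (by omega) (by omega) h2)
  have hval : ((i0 : ZMod n)).val = i0 := ZMod.val_natCast_of_lt (by omega)
  set d : ZMod n := (i0 : ZMod n) with hd
  have hd0 : d ≠ 0 := by
    rw [Ne, ← ZMod.val_eq_zero, hval]; omega
  have hSd : S d := ⟨hd0, by rw [hval]; exact hai⟩
  obtain ⟨δ, hδ0, hδ1, hδ2, hδ⟩ := exists_delta n hn S hS d hSd hd0
  have h2d : d ≠ -d := by
    intro h
    have := hS d hSd
    rw [← h] at this
    exact this hSd
  obtain ⟨r, s, hrs, h2r, h2s⟩ : ∃ r s : ℕ, r + s = q - 1 ∧ 2 * r ≤ q ∧ 2 * s ≤ q :=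
    ⟨q / 2, q - 1 - q / 2, by omega, by omega, by omega⟩
  have key := multinomial_two ((0, d) : ZMod n × ZMod n) (δ, δ + d)
    (by intro h; exact hδ0 (congrArg Prod.fst h).symm) r s
    (fun i => (if i = (0, d) then r else 0) + (if i = (δ, δ + d) then s else 0)) (fun i => rfl)
  have hksum : ∑ i : ZMod n × ZMod n,
      ((if i = (0, d) then r else 0) + (if i = (δ, δ + d) then s else 0)) = q - 1 := by
    simp only [Finset.sum_add_distrib, Finset.sum_ite_eq', Finset.mem_univ, if_true, hrs]
  have huq := edge_unique q n hq3 (by omega) S d δ hd0 (hS d hSd) h2d hδ0 hδ1 hδ2 hδ r s hrs h2r h2s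
  refine core_A (E := E) (ι := ZMod n × ZMod n) (q - 1)
    (fun i => a (i.2 - i.1).val ^ q ^ i.1.val)
    (fun i => q ^ i.2.val + (q ^ n - 1 - 1) * q ^ i.1.val) ?_
    (fun i => (if i = (0, d) then r else 0) + (if i = (δ, δ + d) then s else 0)) hksum ?_ ?_ ?_
  · intro x hx
    rw [← hT x hx, T_edges p m q n hq E hE a x hx]
  · -- otherwise the loop at 0 would give the same exponent
    rw [hE]
    intro hdvd
    have hz := huq (fun i => if i = (0, 0) then q - 1 else 0) _ (fun i => rfl) (by simp) (by
      intro t h hne hth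
      have h00 : (t, h) = ((0, 0) : ZMod n × ZMod n) := by
        by_contra hc
        exact hne (if_neg hc)
      exact absurd ((congrArg Prod.fst h00).trans (congrArg Prod.snd h00).symm) hth) (by
        refine Nat.ModEq.trans ?_ ((Nat.modEq_zero_iff_dvd).2 hdvd).symm
        rw [Nat.modEq_zero_iff_dvd]
        have h1 : 1 < q ^ n := Nat.one_lt_pow (by omega) (by omega)
        refine ⟨q - 1, ?_⟩
        simp only [ite_mul, zero_mul, Finset.sum_ite_eq', Finset.mem_univ, if_true, ZMod.val_zero, pow_zero, mul_one]
        rw [mul_comm]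
        congr 1
        omega)
    have := congrFun hz (0, 0)
    simp [hd0.symm, hδ0.symm] at this
    omega
  · rw [key.1, key.2 E, hrs, hq, choose_ne_zero p m hp E _ (by omega)]
    refine mul_ne_zero (pow_ne_zero _ (by simp)) (mul_ne_zero (pow_ne_zero _ ?_) (pow_ne_zero _ ?_))
    · apply pow_ne_zero
      simpa using hSd.2
    · apply pow_ne_zero
      simpa using hSd.2
  · intro k hk hkw hmod
    rw [hE] at hmod
    refine huq k _ (fun i => rfl) hk ?_ hmod
    intro t h hne hth
    refine ⟨sub_ne_zero.2 (Ne.symm hth), fun h0 => hkw _ hne ?_⟩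
    simp only [h0]
    exact zero_pow (by positivity)

theorem one_edge (m n : ℕ) [NeZero n] (hq : 2 = 2 ^ m) (hn : 2 ≤ n)
    (E : Type*) [Field E] [Fintype E] [ExpChar E 2] (hE : Fintype.card E = 2 ^ n)
    (a : ℕ → E) (i0 : ℕ) (hi1 : 1 ≤ i0) (hi2 : i0 ≤ n - 1) (hai : a i0 ≠ 0)
    (hT : ∀ x : E, x ≠ 0 →
      (∑ j ∈ Finset.range n, ((∑ i ∈ Finset.range n, a i * x ^ 2 ^ i) / x) ^ 2 ^ j) ^ (2 - 1) = 1) :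
    False := by
  have hval : ((i0 : ZMod n)).val = i0 := ZMod.val_natCast_of_lt (by omega)
  set d : ZMod n := (i0 : ZMod n) with hd
  have hd0 : d ≠ 0 := by
    rw [Ne, ← ZMod.val_eq_zero, hval]; omega
  have key := multinomial_two ((0, d) : ZMod n × ZMod n) (0, 0)
    (by intro h; exact hd0 (congrArg Prod.snd h)) 1 0
    (fun i => (if i = (0, d) then 1 else 0)) (fun i => by simp)
  have huq := edge_unique_two n hn d hd0
  refine core_A (E := E) (ι := ZMod n × ZMod n) (2 - 1)
    (fun i => a (i.2 - i.1).val ^ 2 ^ i.1.val)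
    (fun i => 2 ^ i.2.val + (2 ^ n - 1 - 1) * 2 ^ i.1.val) ?_
    (fun i => (if i = (0, d) then 1 else 0)) (by simp) ?_ ?_ ?_
  · intro x hx
    rw [← hT x hx, T_edges 2 m 2 n hq E hE a x hx]
  · rw [hE]
    intro hdvd
    have hz := huq (fun i => if i = (0, 0) then 1 else 0) _ (fun i => rfl) (by simp) (by
        refine Nat.ModEq.trans ?_ ((Nat.modEq_zero_iff_dvd).2 hdvd).symm
        rw [Nat.modEq_zero_iff_dvd]
        have h1 : 1 < 2 ^ n := Nat.one_lt_pow (by omega) (by omega)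
        refine ⟨1, ?_⟩
        simp only [ite_mul, zero_mul, Finset.sum_ite_eq', Finset.mem_univ, if_true, ZMod.val_zero, pow_zero, mul_one, one_mul]
        omega)
    have := congrFun hz (0, 0)
    simp [hd0.symm] at this
  · rw [key.1, key.2 E]
    simpa [hval] using hai
  · intro k hk hkw hmod
    rw [hE] at hmod
    exact huq k _ (fun i => rfl) hk hmod

/-- Hasse–Weil–Serre condition, case `Tr(a_0) ≠ 0`: with `ℓ` as in the
paper, if `q^n + 1 − ((q−1)(ℓ−1)/2)·⌊2 q^{n/2}⌋ > 1`, then there is a nonzero `x` with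
`Tr_{q^n/q}(L(x)/x) = 0`. -/
theorem stmt_14 (p m q n : ℕ) (hp : p.Prime) (hm : 1 ≤ m) (hq : q = p ^ m) (hn : 1 ≤ n)
    (E : Type*) [Field E] [Fintype E] (hE : Fintype.card E = q ^ n)
    (a : ℕ → E) (ha : ∃ i : ℕ, 1 ≤ i ∧ i ≤ n - 1 ∧ a i ≠ 0)
    (ell : ℕ)
    (hell : ell = sInf {w : ℕ | ∃ j : ℕ, 1 ≤ j ∧ j ≤ q ^ n - 2 ∧
        Nat.gcd j (q ^ n - 1) = 1 ∧
        w = sSup {k : ℕ | ∃ i : ℕ, 1 ≤ i ∧ i ≤ n - 1 ∧ a i ≠ 0 ∧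
            k = leadFn p (q ^ n - 1) (j * (q ^ i - 1) % (q ^ n - 1))}})
    (hTr : ∑ j ∈ Finset.range n, (a 0) ^ q ^ j ≠ 0)
    (hbound : (q : ℝ) ^ n + 1 -
        (((q : ℝ) - 1) * ((ell : ℝ) - 1) / 2) * (⌊2 * Real.sqrt ((q : ℝ) ^ n)⌋₊ : ℝ) > 1) :
    ∃ x : E, x ≠ 0 ∧
      ∑ j ∈ Finset.range n, ((∑ i ∈ Finset.range n, a i * x ^ q ^ i) / x) ^ q ^ j = 0 := by
  by_contra hcon
  push Not at hcon
  obtain ⟨i0, hi1, hi2, hai⟩ := ha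
  have hn2 : 2 ≤ n := by omega
  have : NeZero n := ⟨by omega⟩
  have hq2 : 2 ≤ q := by
    rw [hq]; exact hp.two_le.trans (Nat.le_self_pow (by omega) p)
  have : Fact p.Prime := ⟨hp⟩
  have hchar : CharP E p := by
    apply charP_of_card_eq_prime_pow (f := m * n)
    rw [hE, hq, pow_mul]
  have hexp : ExpChar E p := ExpChar.prime hp
  have hT : ∀ x : E, x ≠ 0 →
      (∑ j ∈ Finset.range n, ((∑ i ∈ Finset.range n, a i * x ^ q ^ i) / x) ^ q ^ j) ^ (q - 1) = 1 := by
    intro x hx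
    have h0 := hcon x hx
    generalize (∑ i ∈ Finset.range n, a i * x ^ q ^ i) / x = z at h0 ⊢
    have h1 : (∑ j ∈ Finset.range n, z ^ q ^ j) ^ q = ∑ j ∈ Finset.range n, z ^ q ^ j := by
      have e1 : (∑ j ∈ Finset.range n, z ^ q ^ j) ^ q = ∑ j ∈ Finset.range n, z ^ q ^ (j + 1) := by
        nth_rewrite 2 [hq]
        rw [sum_pow_char_pow]
        refine Finset.sum_congr rfl fun j _ => ?_
        rw [← hq, ← pow_mul, pow_succ]
      rw [e1]
      have e2 := Finset.sum_range_succ (fun j => z ^ q ^ j) n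
      have e3 := Finset.sum_range_succ' (fun j => z ^ q ^ j) n
      have e4 : z ^ q ^ n = z := by rw [← hE]; exact FiniteField.pow_card z
      simp only [pow_zero, pow_one] at e3
      rw [e4, e3] at e2
      exact add_right_cancel e2
    have h2 : q = (q - 1) + 1 := by omega
    rw [h2, pow_succ, ← h2] at h1
    exact mul_right_cancel₀ h0 (by rw [h1, one_mul])
  obtain ⟨j, hlead⟩ := lead_facts p m q n hp hm hq hn2 a ell hell
  have hell1 : 1 ≤ ell ∧ q - 1 ≤ ell := by
    obtain ⟨A, u, _, h1, h2, h3⟩ := hlead i0 hi1 hi2 hai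
    omega
  obtain ⟨f, hf1, hf2, hb⟩ := bound_facts q n ell (by omega) hell1.1 hbound
  rcases Nat.lt_or_ge q 3 with hq3 | hq3
  · have h2 : q = 2 := by omega
    subst h2
    have hp2 : p = 2 := by
      have : p ∣ 2 := by rw [hq]; exact dvd_pow_self p (by omega)
      exact (Nat.prime_dvd_prime_iff_eq hp Nat.prime_two).1 this
    subst hp2
    exact one_edge m n hq hn2 E hE a i0 hi1 hi2 hai hT
  by_cases hex : q = 3 ∧ n = 2
  · obtain ⟨rfl, rfl⟩ := hex
    have hi : i0 = 1 := by omega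
    subst hi
    refine exc_case p m 3 1 1 hq (by omega) E hp hE a hai (by omega) (by omega) ?_ hTr hT (by decide) ?_
    · intro i h1 h2 h3; omega
    · intro k0 k hk hmod
      rw [Fin.sum_univ_two] at hk hmod
      simp [Nat.ModEq] at hmod
      rw [Fin.forall_fin_two]
      simp
      omega
  have hanti : ∀ i, 1 ≤ i → i ≤ n - 1 → a i ≠ 0 → a (n - i) = 0 := by
    intro i h1 h2 h3
    by_contra h4
    obtain ⟨A, u, hA, hA1, hA2, _⟩ := hlead i h1 h2 h3
    obtain ⟨B, v, hB, hB1, hB2, _⟩ := hlead (n - i) (by omega) (by omega) h4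
    have hz := antisym_aux p m n A B i (n - i) u v j hn hm hp.two_le (by omega) hA1 hB1
    rw [← hq] at hz
    obtain ⟨P, hP, hor⟩ := hz hA hB
    refine num1 q n ell P f hq3 hn2 hex hell1.1 ?_ hP hf1 hf2 hb
    have c1 : A * P ≤ ell * P := Nat.mul_le_mul_right _ hA2
    have c2 : B * P ≤ ell * P := Nat.mul_le_mul_right _ hB2
    rw [mul_add, mul_one]
    rcases hor with h | h <;> omega
  rcases Nat.lt_or_ge n 4 with hn4 | hn4
  · rcases Nat.lt_or_ge n 3 with hn3 | hn3
    · have : n = 2 := by omega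
      subst this
      have hi : i0 = 1 := by omega
      subst hi
      exact hai (hanti 1 (by omega) (by omega) hai)
    have : n = 3 := by omega
    subst this
    rcases Nat.lt_or_ge q 5 with hq5 | hq5
    · have hz := hanti i0 hi1 hi2 hai
      have haz : ∀ i, i < 2 + 1 → i ≠ 0 → i ≠ i0 → a i = 0 := by
        intro i h1 h2 h3
        have : i = 3 - i0 := by omega
        rw [this]; exact hz
      refine exc_case p m q 2 i0 hq (by omega) E hp hE a hai hi1 (by omega) haz hTr hT ?_ ?_
      · have : q = 3 ∨ q = 4 := by omega
        have : i0 = 1 ∨ i0 = 2 := by omega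
        rcases ‹q = 3 ∨ q = 4› with h | h <;> rcases ‹i0 = 1 ∨ i0 = 2› with h' | h' <;>
          rw [h, h'] <;> decide
      · intro k0 k hk hmod
        rw [Fin.sum_univ_three] at hk hmod
        have : q = 3 ∨ q = 4 := by omega
        have : i0 = 1 ∨ i0 = 2 := by omega
        have hfin : (∀ c : Fin 3, k c = if c = 0 then 1 else 0) ↔ (k 0 = 1 ∧ k 1 = 0 ∧ k 2 = 0) := by
          simp [Fin.forall_fin_succ]
        refine (and_congr_right fun _ => hfin).2 ?_
        rcases ‹q = 3 ∨ q = 4› with h | h <;> rcases ‹i0 = 1 ∨ i0 = 2› with h' | h' <;>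
          rw [h, h'] at hmod <;> rw [h] at hk ⊢ <;> simp [Nat.ModEq] at hmod <;>
          clear hfin hT hz haz hlead hanti hTr <;>
          generalize k 0 = x at * <;> generalize k 1 = y at * <;> generalize k 2 = z at * <;>
          (have hx : x ≤ 3 := by omega) <;> (have hy : y ≤ 3 := by omega) <;>
          interval_cases x <;> interval_cases y <;> omega
    · exact num2 q ell f hq5 hell1.2 hf2 hb
  · exact two_edges p m q n hp hq hq3 hn4 E hE a i0 hi1 hi2 hai hanti hT
end
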